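/- Let p, q, σ₁, σ₂ ∈ (0,∞], α₁, α₂ ∈ ℝ, α₃ ≥ 0, {t_k} ∈ 𝒳^{α₃}_{α,σ,p} (α = (α₁,α₂), σ = (σ₁,σ₂)), and let φ₀ ∈ D(ℝⁿ) with ∫φ₀ = 1. Then there exist constants C, N > 0 and L ∈ ℕ (depending on {t_k}, p, q, n, φ₀ but not on f or θ̃) such that for every f ∈ B^{φ₀}_{p,q}({t_k}), every θ̃ ∈ D(I) (where I = [−1,1]ⁿ) and every x ∈ ℝⁿ: |θ̃ ∗ f(x)| ≤ C ‖f | B^{φ₀}_{p,q}({t_k})‖ · (sup_{x̃∈ℝⁿ} Σ_{|β| ≤ L} |D^β θ̃(x̃)|) · e^{N|x|}. -/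

import Mathlib

open MeasureTheory ENNReal Filter Topology

noncomputable section

def lqNorm (q : ℝ≥0∞) (a : ℕ → ℝ≥0∞) : ℝ≥0∞ :=
  if q = ∞ then ⨆ k, a k else (∑' k, a k ^ q.toReal) ^ (1 / q.toReal)

def lpSum {ι : Type*} (p : ℝ≥0∞) (a : ι → ℝ≥0∞) : ℝ≥0∞ :=
  if p = ∞ then ⨆ m, a m else (∑' m, a m ^ p.toReal) ^ (1 / p.toReal)

def dyadicCube (n k : ℕ) (m : Fin n → ℤ) : Set (Fin n → ℝ) :=
  {x | ∀ i, (m i : ℝ) / 2 ^ k ≤ x i ∧ x i ≤ ((m i : ℝ) + 1) / 2 ^ k}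

def dilatedCube (n : ℕ) (c : ℝ) (k : ℕ) (m : Fin n → ℤ) : Set (Fin n → ℝ) :=
  {x | ∀ i, |x i - ((m i : ℝ) + 1 / 2) / 2 ^ k| ≤ c / (2 * 2 ^ k)}

def tkm (n : ℕ) (p : ℝ≥0∞) (t : ℕ → (Fin n → ℝ) → ℝ) (k : ℕ) (m : Fin n → ℤ) : ℝ≥0∞ :=
  eLpNorm (t k) p (volume.restrict (dyadicCube n k m))

def PAdmissible (n : ℕ) (p : ℝ≥0∞) (t : ℕ → (Fin n → ℝ) → ℝ) : Prop :=
  (∀ k, Measurable (t k)) ∧ (∀ k, ∀ᵐ x : Fin n → ℝ, 0 < t k x) ∧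
    ∀ k m, tkm n p t k m < ∞

def MemX (n : ℕ) (p σ₁ σ₂ : ℝ≥0∞) (α₁ α₂ α₃ : ℝ) (t : ℕ → (Fin n → ℝ) → ℝ) : Prop :=
  PAdmissible n p t ∧
  (∃ C₁ : ℝ, 0 < C₁ ∧ ∀ k j : ℕ, k ≤ j → ∀ m : Fin n → ℤ,
    (((2 : ℝ≥0∞) ^ (k * n)) ^ p⁻¹.toReal * tkm n p t k m) *
      (((2 : ℝ≥0∞) ^ (k * n)) ^ σ₁⁻¹.toReal *
        eLpNorm (fun x => (t j x)⁻¹) σ₁ (volume.restrict (dyadicCube n k m)))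
      ≤ ENNReal.ofReal (C₁ * 2 ^ (α₁ * ((k : ℝ) - (j : ℝ))))) ∧
  (∃ C₂ : ℝ, 0 < C₂ ∧ ∀ k j : ℕ, k ≤ j → ∀ m : Fin n → ℤ,
    ((2 : ℝ≥0∞) ^ (k * n)) ^ σ₂⁻¹.toReal *
        eLpNorm (t j) σ₂ (volume.restrict (dyadicCube n k m))
      ≤ ENNReal.ofReal (C₂ * 2 ^ (α₂ * ((j : ℝ) - (k : ℝ)))) *
        (((2 : ℝ≥0∞) ^ (k * n)) ^ p⁻¹.toReal * tkm n p t k m)) ∧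
  (∀ k m, 0 < tkm n p t k m) ∧
  (∀ (k : ℕ) (m m' : Fin n → ℤ), (∀ i, |m i - m' i| ≤ 1) →
    tkm n p t k m ≤ ENNReal.ofReal (2 ^ α₃) * tkm n p t k m')

def tbar (n : ℕ) (p : ℝ≥0∞) (t : ℕ → (Fin n → ℝ) → ℝ) (k : ℕ) (x : Fin n → ℝ) : ℝ :=
  (2 : ℝ) ^ (((k * n : ℕ) : ℝ) / p.toReal) * (tkm n p t k fun i => ⌊x i * 2 ^ k⌋).toReal

abbrev Dstrb (n : ℕ) := ((Fin n → ℝ) → ℝ) →ₗ[ℝ] ℝ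

def distConv (n : ℕ) (f : Dstrb n) (φ : (Fin n → ℝ) → ℝ) (x : Fin n → ℝ) : ℝ :=
  f fun y => φ (x - y)

def IsTestFun (n : ℕ) (g : (Fin n → ℝ) → ℝ) : Prop :=
  ContDiff ℝ (⊤ : ℕ∞) g ∧ HasCompactSupport g

def phiOf (n : ℕ) (φ₀ : (Fin n → ℝ) → ℝ) (x : Fin n → ℝ) : ℝ :=
  φ₀ x - (2 : ℝ)⁻¹ ^ n * φ₀ ((2 : ℝ)⁻¹ • x)

def phiFam (n : ℕ) (φ₀ : (Fin n → ℝ) → ℝ) : ℕ → (Fin n → ℝ) → ℝ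
  | 0 => φ₀
  | k + 1 => fun x => (2 : ℝ) ^ ((k + 1) * n) * phiOf n φ₀ ((2 : ℝ) ^ (k + 1) • x)

def kernFam (n : ℕ) (ψ₀ ψ : (Fin n → ℝ) → ℝ) : ℕ → (Fin n → ℝ) → ℝ
  | 0 => ψ₀
  | k + 1 => fun x => (2 : ℝ) ^ ((k + 1) * n) * ψ ((2 : ℝ) ^ (k + 1) • x)

def besovNorm (n : ℕ) (p q : ℝ≥0∞) (t : ℕ → (Fin n → ℝ) → ℝ)
    (φ₀ : (Fin n → ℝ) → ℝ) (f : Dstrb n) : ℝ≥0∞ :=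
  lqNorm q fun k =>
    eLpNorm (fun x => t k x * distConv n f (phiFam n φ₀ k) x) p volume

def seSeminorm (n : ℕ) (N : ℕ) (g : (Fin n → ℝ) → ℝ) : ℝ≥0∞ :=
  ⨆ x : Fin n → ℝ, ENNReal.ofReal
    (Real.exp (N * ‖x‖) * ∑ i ∈ Finset.range (N + 1), ‖iteratedFDeriv ℝ i g x‖)

def MemSe' (n : ℕ) (f : Dstrb n) : Prop :=
  ∃ (C : ℝ) (N : ℕ), 0 < C ∧ ∀ g : (Fin n → ℝ) → ℝ, ContDiff ℝ (⊤ : ℕ∞) g →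
    ENNReal.ofReal |f g| ≤ ENNReal.ofReal C * seSeminorm n N g

def MomentsVanish (n : ℕ) (L : ℤ) (ψ : (Fin n → ℝ) → ℝ) : Prop :=
  ∀ β : Fin n → ℕ, ((∑ i, β i : ℕ) : ℤ) ≤ L → (∫ x, (∏ i, x i ^ β i) * ψ x) = 0


/-- The unit cube `I = [-1,1]^n`. -/
def unitCube (n : ℕ) : Set (Fin n → ℝ) := {x | ∀ i, |x i| ≤ 1}

open ContinuousLinearMap in
/-- convolution of a scalar function with a vector valued function -/
def cvl {n : ℕ} {F : Type} [NormedAddCommGroup F] [NormedSpace ℝ F]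
    (u : (Fin n → ℝ) → ℝ) (v : (Fin n → ℝ) → F) (x : Fin n → ℝ) : F :=
  ∫ y, u y • v (x - y)

section Conv
variable {n : ℕ} {F : Type} [NormedAddCommGroup F] [NormedSpace ℝ F]

lemma cvl_eq (u : (Fin n → ℝ) → ℝ) (v : (Fin n → ℝ) → F) :
    cvl u v = convolution u v (ContinuousLinearMap.lsmul ℝ ℝ) volume := by
  ext x; rfl

lemma cvl_contDiff {u : (Fin n → ℝ) → ℝ} {v : (Fin n → ℝ) → F}
    (hu : Continuous u) (hv : ContDiff ℝ (⊤ : ℕ∞) v) (hvc : HasCompactSupport v) :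
    ContDiff ℝ (⊤ : ℕ∞) (cvl u v) := by
  rw [cvl_eq]
  exact hvc.contDiff_convolution_right _ hu.locallyIntegrable hv

lemma cvl_compact {u : (Fin n → ℝ) → ℝ} {v : (Fin n → ℝ) → F}
    (hu : HasCompactSupport u) (hvc : HasCompactSupport v) :
    HasCompactSupport (cvl u v) := by
  rw [cvl_eq]
  exact hu.convolution _ hvc

lemma cvl_integrable {u : (Fin n → ℝ) → ℝ} {v : (Fin n → ℝ) → F}
    (hu : Continuous u) (huc : HasCompactSupport u) (hv : Continuous v) (x : Fin n → ℝ) :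
    Integrable (fun y => u y • v (x - y)) :=
  (hu.smul (hv.comp (continuous_const.sub continuous_id))).integrable_of_hasCompactSupport
    huc.smul_right

lemma cvl_iteratedFDeriv (l : ℕ) : ∀ {F : Type} [NormedAddCommGroup F] [NormedSpace ℝ F] [CompleteSpace F]
    {u : (Fin n → ℝ) → ℝ} {v : (Fin n → ℝ) → F}
    (_ : Continuous u) (_ : HasCompactSupport u) (_ : ContDiff ℝ (⊤ : ℕ∞) v)
    (_ : HasCompactSupport v) (x : Fin n → ℝ),
    iteratedFDeriv ℝ l (cvl u v) x = cvl u (iteratedFDeriv ℝ l v) x := by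
  induction l with
  | zero =>
    intro F _ _ _ u v hu huc hv hvc x
    simp only [iteratedFDeriv_zero_eq_comp, cvl, Function.comp_apply]
    have := ((continuousMultilinearCurryFin0 ℝ (Fin n → ℝ) F).symm.toContinuousLinearEquiv.toContinuousLinearMap).integral_comp_comm
      (cvl_integrable hu huc hv.continuous x)
    simp only [map_smul] at this
    exact this.symm
  | succ l ih =>
    intro F _ _ _ u v hu huc hv hvc x
    have hd : fderiv ℝ (cvl u v) = cvl u (fderiv ℝ v) := by
      ext1 z
      have := (hvc.hasFDerivAt_convolution_right (ContinuousLinearMap.lsmul ℝ ℝ)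
        (hu.locallyIntegrable (μ := volume)) (hv.of_le (by exact_mod_cast le_top)) z).fderiv
      rw [← cvl_eq] at this
      rw [this]
      rfl
    have hv' : ContDiff ℝ (⊤ : ℕ∞) (fderiv ℝ v) := hv.fderiv_right (by simp)
    have hvc' : HasCompactSupport (fderiv ℝ v) := hvc.fderiv ℝ
    have hfun : ∀ g : (Fin n → ℝ) → F, iteratedFDeriv ℝ (l + 1) g = fun z =>
        (continuousMultilinearCurryRightEquiv' ℝ l (Fin n → ℝ) F).symm
          (iteratedFDeriv ℝ l (fderiv ℝ g) z) := fun g => by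
      ext1 z; exact iteratedFDeriv_succ_eq_comp_right
    rw [hfun, hfun, hd]
    have h1 := ih hu huc hv' hvc' x
    have h2 := ((continuousMultilinearCurryRightEquiv' ℝ l (Fin n → ℝ) F).symm.toContinuousLinearEquiv.toContinuousLinearMap).integral_comp_comm
      (cvl_integrable hu huc (hv'.continuous_iteratedFDeriv (m := l) (by exact_mod_cast le_top)) x)
    simp only [map_smul] at h2
    refine Eq.trans ?_ h2.symm
    exact congrArg _ h1

lemma cvl_comm (u v : (Fin n → ℝ) → ℝ) : cvl u v = cvl v u := by
  ext x
  simp only [cvl]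
  rw [← integral_sub_left_eq_self _ volume x]
  simp [mul_comm]

lemma cvl_add (u : (Fin n → ℝ) → ℝ) {v w : (Fin n → ℝ) → ℝ} (hu : Continuous u)
    (huc : HasCompactSupport u) (hv : Continuous v) (hw : Continuous w) :
    cvl u (v + w) = cvl u v + cvl u w := by
  ext x
  simp only [cvl, Pi.add_apply, smul_add]
  exact integral_add (cvl_integrable hu huc hv x) (cvl_integrable hu huc hw x)

lemma cvl_smul (c : ℝ) (u : (Fin n → ℝ) → ℝ) (v : (Fin n → ℝ) → ℝ) :
    cvl u (c • v) = c • cvl u v := by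
  ext x
  simp only [cvl, Pi.smul_apply, smul_comm _ c]
  exact integral_smul c _

lemma cvl_assoc {u v w : (Fin n → ℝ) → ℝ} (hu : Continuous u)
    (huc : HasCompactSupport u) (hv : Continuous v) (hvc : HasCompactSupport v)
    (hw : Continuous w) (hwc : HasCompactSupport w) :
    cvl (cvl u v) w = cvl u (cvl v w) := by
  ext x
  simp only [cvl_eq]
  have hg : Continuous (convolution (fun x => ‖v x‖) (fun x => ‖w x‖)
      (ContinuousLinearMap.mul ℝ ℝ) volume) :=
    hwc.norm.continuous_convolution_right _ hv.norm.locallyIntegrable hw.norm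
  refine convolution_assoc _ _ _ _ (by intros; simp [mul_assoc]) hu.aestronglyMeasurable
    hv.aestronglyMeasurable hw.aestronglyMeasurable
    (Eventually.of_forall fun y => ?_) (Eventually.of_forall fun y => ?_) ?_
  · exact hvc.convolutionExists_right _ hu.locallyIntegrable hv y
  · exact hwc.norm.convolutionExists_right _ hv.norm.locallyIntegrable hw.norm y
  · exact huc.norm.convolutionExists_left _ hu.norm hg.locallyIntegrable x
end Conv

section Functional
variable {n : ℕ}

/-- vanishing outside the closed ball of radius `ρ` -/
def SuppB {n : ℕ} {F : Type} [Zero F] (ρ : ℝ) (v : (Fin n → ℝ) → F) : Prop :=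
  ∀ x, ρ < ‖x‖ → v x = 0

lemma IsTestFun.exists_suppB {v : (Fin n → ℝ) → ℝ} (hv : IsTestFun n v) :
    ∃ ρ : ℝ, 0 < ρ ∧ SuppB ρ v := by
  obtain ⟨R, hR⟩ := hv.2.isCompact.isBounded.subset_closedBall 0
  refine ⟨max R 1, by positivity, fun x hx => ?_⟩
  by_contra h
  have := hR (subset_tsupport _ (Function.mem_support.2 h))
  rw [mem_closedBall_zero_iff] at this
  exact absurd (lt_of_le_of_lt (le_max_left _ _) hx) (not_lt.2 this)

lemma SuppB.tsupport_subset {v : (Fin n → ℝ) → ℝ} {ρ : ℝ} (hv : SuppB ρ v) :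
    tsupport v ⊆ Metric.closedBall 0 ρ := by
  refine closure_minimal (fun x hx => ?_) Metric.isClosed_closedBall
  rw [mem_closedBall_zero_iff]
  by_contra h
  exact hx (hv x (not_le.1 h))

lemma SuppB.iteratedFDeriv {v : (Fin n → ℝ) → ℝ} {ρ : ℝ} (hv : SuppB ρ v) (i : ℕ) :
    SuppB ρ (iteratedFDeriv ℝ i v) := by
  intro x hx
  by_contra h
  have := hv.tsupport_subset (support_iteratedFDeriv_subset (𝕜 := ℝ) i (Function.mem_support.2 h))
  rw [mem_closedBall_zero_iff] at this
  linarith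

lemma SuppB.hasCompactSupport {v : (Fin n → ℝ) → ℝ} {ρ : ℝ} (hv : SuppB ρ v) :
    HasCompactSupport v :=
  HasCompactSupport.of_support_subset_isCompact (isCompact_closedBall 0 ρ)
    ((subset_tsupport _).trans hv.tsupport_subset)

lemma SuppB.mono {F : Type} [Zero F] {v : (Fin n → ℝ) → F} {ρ ρ' : ℝ} (hv : SuppB ρ v)
    (h : ρ ≤ ρ') : SuppB ρ' v := fun x hx => hv x (lt_of_le_of_lt h hx)

lemma IsTestFun.exists_bound {v : (Fin n → ℝ) → ℝ} (hv : IsTestFun n v) (i : ℕ) :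
    ∃ B : ℝ, 0 ≤ B ∧ ∀ x, ‖iteratedFDeriv ℝ i v x‖ ≤ B := by
  obtain ⟨B, hB⟩ := (hv.2.iteratedFDeriv (𝕜 := ℝ) i).exists_bound_of_continuous
    (hv.1.continuous_iteratedFDeriv (m := i) (by exact_mod_cast le_top))
  exact ⟨B, (norm_nonneg _).trans (hB 0), hB⟩

lemma IsTestFun.iterated_continuous {v : (Fin n → ℝ) → ℝ} (hv : IsTestFun n v) (i : ℕ) :
    Continuous (iteratedFDeriv ℝ i v) :=
  hv.1.continuous_iteratedFDeriv (m := i) (by exact_mod_cast le_top)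

lemma IsTestFun.lip {v : (Fin n → ℝ) → ℝ} (hv : IsTestFun n v) (i : ℕ) {B : ℝ}
    (hB : ∀ x, ‖iteratedFDeriv ℝ (i + 1) v x‖ ≤ B) (x y : Fin n → ℝ) :
    ‖iteratedFDeriv ℝ i v x - iteratedFDeriv ℝ i v y‖ ≤ B * ‖x - y‖ := by
  refine Convex.norm_image_sub_le_of_norm_fderiv_le (𝕜 := ℝ) (s := Set.univ)
    (fun z _ => ?_) (fun z _ => ?_) convex_univ trivial trivial
  · exact (hv.1.differentiable_iteratedFDeriv (m := i) (by exact_mod_cast ENat.natCast_lt_top i)) z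
  · rw [norm_fderiv_iteratedFDeriv]; exact hB z

lemma iteratedFDeriv_refl {v : (Fin n → ℝ) → ℝ} (hv : ContDiff ℝ (⊤ : ℕ∞) v) (i : ℕ)
    (a z : Fin n → ℝ) :
    iteratedFDeriv ℝ i (fun z => v (a - z)) z = (-1 : ℝ) ^ i • iteratedFDeriv ℝ i v (a - z) := by
  have h1 : ContDiff ℝ i (fun w => v (a + w)) :=
    (hv.comp (contDiff_const.add contDiff_id)).of_le (by exact_mod_cast le_top)
  have h2 := congrFun (iteratedFDeriv_comp_const_smul (-1 : ℝ) h1) z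
  simp only [iteratedFDeriv_comp_add_left] at h2
  simpa [sub_eq_add_neg] using h2

lemma isTestFun_refl {v : (Fin n → ℝ) → ℝ} (hv : IsTestFun n v) (a : Fin n → ℝ) :
    IsTestFun n (fun z => v (a - z)) :=
  ⟨hv.1.comp (contDiff_const.sub contDiff_id),
    hv.2.comp_homeomorph (Homeomorph.subLeft a)⟩

/-- the submodule of test functions -/
def TD (n : ℕ) : Submodule ℝ ((Fin n → ℝ) → ℝ) where
  carrier := {g | IsTestFun n g}
  add_mem' := fun ha hb => ⟨ha.1.add hb.1, ha.2.add hb.2⟩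
  zero_mem' := ⟨contDiff_const, HasCompactSupport.zero⟩
  smul_mem' := fun c _ ha => ⟨contDiff_const.smul ha.1, ha.2.smul_left (f := fun _ => c)⟩

/-- the Banach space hosting weighted jets -/
abbrev XB (n N : ℕ) : Type :=
  (i : Fin (N + 1)) → BoundedContinuousFunction (Fin n → ℝ) ((Fin n → ℝ) [×(i : ℕ)]→L[ℝ] ℝ)

instance instNormedXB (n N : ℕ) : NormedAddCommGroup (XB n N) := Pi.normedAddCommGroup

instance instSpaceXB (n N : ℕ) : NormedSpace ℝ (XB n N) := Pi.normedSpace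

lemma exists_jet_bound (N i : ℕ) (g : TD n) : ∃ C, ∀ z : Fin n → ℝ,
    ‖Real.exp (N * ‖z‖) • iteratedFDeriv ℝ i g.1 z‖ ≤ C := by
  have hg : IsTestFun n g.1 := g.2
  have hc : Continuous fun z : Fin n → ℝ => Real.exp (N * ‖z‖) • iteratedFDeriv ℝ i g.1 z :=
    (by fun_prop : Continuous fun z : Fin n → ℝ => Real.exp (N * ‖z‖)).smul
      (hg.iterated_continuous i)
  exact HasCompactSupport.exists_bound_of_continuous
    ((hg.2.iteratedFDeriv (𝕜 := ℝ) i).smul_left (f := fun z => Real.exp (N * ‖z‖))) hc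

/-- the weighted jet map -/
def jet (n N : ℕ) : TD n →ₗ[ℝ] XB n N where
  toFun g := fun i => BoundedContinuousFunction.ofNormedAddCommGroup
    (fun z => Real.exp (N * ‖z‖) • iteratedFDeriv ℝ i g.1 z)
    ((by fun_prop : Continuous fun z : Fin n → ℝ => Real.exp (N * ‖z‖)).smul
      (IsTestFun.iterated_continuous g.2 i)) _ (exists_jet_bound N i g).choose_spec
  map_add' := fun g h => by
    ext1 i
    ext1 z
    have hg : IsTestFun n g.1 := g.2
    have hh : IsTestFun n h.1 := h.2
    have := iteratedFDeriv_add_apply (𝕜 := ℝ) (i := i) (x := z) (f := g.1) (g := h.1)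
      ((hg.1.of_le (by exact_mod_cast le_top)).contDiffAt)
      ((hh.1.of_le (by exact_mod_cast le_top)).contDiffAt)
    simp only [Pi.add_apply, BoundedContinuousFunction.coe_ofNormedAddCommGroup,
      BoundedContinuousFunction.coe_add, Submodule.coe_add, this, smul_add]
  map_smul' := fun c g => by
    ext1 i
    ext1 z
    have hg : IsTestFun n g.1 := g.2
    have := iteratedFDeriv_const_smul_apply (𝕜 := ℝ) (i := i) (x := z) (f := g.1) (a := c)
      ((hg.1.of_le (by exact_mod_cast le_top)).contDiffAt)
    simp only [Pi.smul_apply, BoundedContinuousFunction.coe_ofNormedAddCommGroup,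
      BoundedContinuousFunction.coe_smul, Submodule.coe_smul, this, RingHom.id_apply]
    rw [smul_comm]

lemma jet_apply (N : ℕ) (g : TD n) (i : Fin (N + 1)) (z : Fin n → ℝ) :
    jet n N g i z = Real.exp (N * ‖z‖) • iteratedFDeriv ℝ i g.1 z := rfl

lemma jet_injective (N : ℕ) : Function.Injective (jet n N) := by
  intro g h hgh
  ext z
  have h1 := congrArg (fun w => w 0 z) hgh
  simp only [jet_apply] at h1
  have h2 := smul_right_injective _ (Real.exp_pos (N * ‖z‖)).ne' h1
  have h3 := congrArg (fun w => w 0) h2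
  exact h3

lemma se_le_jet (N : ℕ) (g : TD n) :
    seSeminorm n N g.1 ≤ ENNReal.ofReal ((N + 1) * ‖jet n N g‖) := by
  refine iSup_le fun x => ENNReal.ofReal_le_ofReal ?_
  rw [Finset.mul_sum]
  have : ∀ i ∈ Finset.range (N + 1),
      Real.exp (N * ‖x‖) * ‖iteratedFDeriv ℝ i g.1 x‖ ≤ ‖jet n N g‖ := by
    intro i hi
    have h1 := ((jet n N g ⟨i, Finset.mem_range.1 hi⟩).norm_coe_le_norm x).trans
      (norm_le_pi_norm (jet n N g) _)
    rwa [jet_apply, norm_smul, Real.norm_of_nonneg (Real.exp_pos _).le] at h1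
  refine (Finset.sum_le_sum this).trans ?_
  simp

lemma exists_extension (f : Dstrb n) {C : ℝ} {N : ℕ}
    (hf : ∀ g : (Fin n → ℝ) → ℝ, ContDiff ℝ (⊤ : ℕ∞) g →
      ENNReal.ofReal |f g| ≤ ENNReal.ofReal C * seSeminorm n N g) :
    ∃ Λ : XB n N →L[ℝ] ℝ, ∀ g : TD n, Λ (jet n N g) = f g.1 := by
  let e := LinearEquiv.ofInjective (jet n N) (jet_injective N)
  let φ : (LinearMap.range (jet n N)) →ₗ[ℝ] ℝ := (f ∘ₗ (TD n).subtype) ∘ₗ e.symm.toLinearMap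
  have hφ : ∀ w, ‖φ w‖ ≤ (max C 0 * (N + 1)) * ‖w‖ := by
    intro w
    obtain ⟨g, rfl⟩ := e.surjective w
    have h1 : φ (e g) = f g.1 := by simp [φ]
    have h2 : ‖e g‖ = ‖jet n N g‖ := rfl
    rw [h1, h2]
    have h3 := hf g.1 (g.2 : IsTestFun n g.1).1
    have h4 := h3.trans (mul_le_mul' (ENNReal.ofReal_le_ofReal (le_max_left C 0)) (se_le_jet N g))
    rw [← ENNReal.ofReal_mul (le_max_right _ _), ENNReal.ofReal_le_ofReal_iff (by positivity)] at h4
    rw [Real.norm_eq_abs]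
    linarith
  obtain ⟨Λ, hΛ, -⟩ := exists_extension_norm_eq (LinearMap.range (jet n N)) (φ.mkContinuous _ hφ)
  refine ⟨Λ, fun g => ?_⟩
  have := hΛ (e g)
  have h1 : φ (e g) = f g.1 := by simp [φ]
  rw [← h1]
  exact this

/-- translated reflection as test function -/
def reflTD (v : (Fin n → ℝ) → ℝ) (hv : IsTestFun n v) (a : Fin n → ℝ) : TD n :=
  ⟨fun z => v (a - z), isTestFun_refl hv a⟩

lemma jet_refl_apply (N : ℕ) {v : (Fin n → ℝ) → ℝ} (hv : IsTestFun n v) (a z : Fin n → ℝ)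
    (i : Fin (N + 1)) : jet n N (reflTD v hv a) i z
      = Real.exp (N * ‖z‖) • ((-1 : ℝ) ^ (i : ℕ) • iteratedFDeriv ℝ i v (a - z)) := by
  rw [jet_apply, reflTD, iteratedFDeriv_refl hv.1]

lemma norm_aux {E : Type} [NormedAddCommGroup E] [NormedSpace ℝ E] (c : ℝ) (i : ℕ) (p q : E) :
    ‖Real.exp c • ((-1 : ℝ) ^ i • p) - Real.exp c • ((-1 : ℝ) ^ i • q)‖
      = Real.exp c * ‖p - q‖ := by
  rw [← smul_sub, ← smul_sub, norm_smul, norm_smul]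
  simp

lemma jet_refl_continuous (N : ℕ) {v : (Fin n → ℝ) → ℝ} (hv : IsTestFun n v) :
    Continuous fun a => jet n N (reflTD v hv a) := by
  refine continuous_pi fun i => continuous_iff_continuousAt.2 fun a => ?_
  obtain ⟨ρ, hρ, hs⟩ := hv.exists_suppB
  obtain ⟨B, hB0, hB⟩ := hv.exists_bound (i + 1)
  have hsi := hs.iteratedFDeriv i
  rw [ContinuousAt, tendsto_iff_dist_tendsto_zero]
  refine squeeze_zero' (Eventually.of_forall fun _ => dist_nonneg)
    (g := fun b => Real.exp (N * (‖a‖ + 1 + ρ)) * (B * ‖b - a‖)) ?_ ?_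
  · filter_upwards [Metric.ball_mem_nhds a one_pos] with b hb
    rw [Metric.mem_ball, dist_eq_norm] at hb
    have hb' : ‖b‖ ≤ ‖a‖ + 1 := by
      have := norm_le_norm_add_norm_sub' b a
      linarith
    rw [BoundedContinuousFunction.dist_le (by positivity)]
    intro z
    rw [dist_eq_norm, jet_refl_apply, jet_refl_apply]
    refine (norm_aux _ _ _ _).trans_le ?_
    by_cases hz : ‖z‖ ≤ ‖a‖ + 1 + ρ
    · have h1 := hv.lip i hB (b - z) (a - z)
      rw [sub_sub_sub_cancel_right] at h1
      gcongr
    · have h1 : ρ < ‖b - z‖ := by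
        have := norm_sub_norm_le z b
        rw [norm_sub_rev] at this
        linarith
      have h2 : ρ < ‖a - z‖ := by
        have := norm_sub_norm_le z a
        rw [norm_sub_rev] at this
        linarith
      rw [hsi _ h1, hsi _ h2]
      simp only [sub_self, norm_zero, mul_zero]
      positivity
  · have : Continuous fun b => Real.exp (N * (‖a‖ + 1 + ρ)) * (B * ‖b - a‖) := by fun_prop
    simpa using this.tendsto a

lemma IsTestFun.cvl {u v : (Fin n → ℝ) → ℝ} (hu : IsTestFun n u) (hv : IsTestFun n v) :
    IsTestFun n (cvl u v) :=
  ⟨cvl_contDiff hu.1.continuous hv.1 hv.2, cvl_compact hu.2 hv.2⟩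

lemma distConv_continuous {f : Dstrb n} (hf : MemSe' n f) {v : (Fin n → ℝ) → ℝ}
    (hv : IsTestFun n v) : Continuous (distConv n f v) := by
  obtain ⟨C, N, hC, h⟩ := hf
  obtain ⟨Λ, hΛ⟩ := exists_extension f h
  have : distConv n f v = fun a => Λ (jet n N (reflTD v hv a)) := by
    ext a; rw [hΛ]; rfl
  rw [this]
  exact Λ.continuous.comp (jet_refl_continuous N hv)

lemma distConv_cvl {f : Dstrb n} (hf : MemSe' n f) {u v : (Fin n → ℝ) → ℝ}
    (hu : IsTestFun n u) (hv : IsTestFun n v) (x : Fin n → ℝ) :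
    distConv n f (cvl u v) x = ∫ y, u y * distConv n f v (x - y) := by
  obtain ⟨C, N, hC, h⟩ := hf
  obtain ⟨Λ, hΛ⟩ := exists_extension f h
  have h1 : ∀ a, distConv n f v a = Λ (jet n N (reflTD v hv a)) := fun a => by rw [hΛ]; rfl
  have h2 : distConv n f (cvl u v) x = Λ (jet n N (reflTD (cvl u v) (hu.cvl hv) x)) := by
    rw [hΛ]; rfl
  have hi : Integrable fun y => u y • jet n N (reflTD v hv (x - y)) :=
    (hu.1.continuous.smul ((jet_refl_continuous N hv).comp
      (continuous_const.sub continuous_id))).integrable_of_hasCompactSupport hu.2.smul_right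
  have h3 : jet n N (reflTD (cvl u v) (hu.cvl hv) x) = ∫ y, u y • jet n N (reflTD v hv (x - y)) := by
    ext1 i
    ext1 z
    have h4 := (((BoundedContinuousFunction.evalCLM ℝ z).comp
      (ContinuousLinearMap.proj (R := ℝ) (φ := fun i : Fin (N + 1) =>
        BoundedContinuousFunction (Fin n → ℝ) ((Fin n → ℝ) [×(i : ℕ)]→L[ℝ] ℝ)) i))).integral_comp_comm hi
    refine Eq.trans ?_ h4
    rw [jet_refl_apply, cvl_iteratedFDeriv i hu.1.continuous hu.2 hv.1 hv.2, _root_.cvl,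
      ← integral_smul, ← integral_smul]
    refine integral_congr_ae (Eventually.of_forall fun y => ?_)
    simp only [map_smul]
    refine Eq.trans ?_ (congrArg (fun w => u y • w) (jet_refl_apply N hv (x - y) z i).symm)
    rw [sub_right_comm, smul_comm _ (u y), smul_comm _ (u y)]
  rw [h2, h3, ← Λ.integral_comp_comm hi]
  simp [h1]

lemma distConv_apriori {f : Dstrb n} {C : ℝ} {N : ℕ} (hC : 0 < C)
    (hf : ∀ g : (Fin n → ℝ) → ℝ, ContDiff ℝ (⊤ : ℕ∞) g →
      ENNReal.ofReal |f g| ≤ ENNReal.ofReal C * seSeminorm n N g)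
    {v : (Fin n → ℝ) → ℝ} (hv : IsTestFun n v) {ρ B : ℝ} (hB0 : 0 ≤ B)
    (hs : SuppB ρ v) (hB : ∀ i ≤ N, ∀ z, ‖iteratedFDeriv ℝ i v z‖ ≤ B) (x : Fin n → ℝ) :
    |distConv n f v x| ≤ C * (Real.exp (N * (‖x‖ + ρ)) * ((N + 1) * B)) := by
  have h1 := hf (fun z => v (x - z)) (isTestFun_refl hv x).1
  have h2 : seSeminorm n N (fun z => v (x - z))
      ≤ ENNReal.ofReal (Real.exp (N * (‖x‖ + ρ)) * ((N + 1) * B)) := by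
    refine iSup_le fun z => ENNReal.ofReal_le_ofReal ?_
    simp only [iteratedFDeriv_refl hv.1, norm_smul, norm_pow, norm_neg, norm_one, one_pow, one_mul]
    by_cases hz : ‖z‖ ≤ ‖x‖ + ρ
    · gcongr
      refine (Finset.sum_le_sum fun i hi => hB i (by simpa [Nat.lt_succ_iff] using hi) _).trans ?_
      simp
    · have h2 : ρ < ‖x - z‖ := by
        have := norm_sub_norm_le z x
        rw [norm_sub_rev] at this
        linarith
      have : ∑ i ∈ Finset.range (N + 1), ‖iteratedFDeriv ℝ i v (x - z)‖ = 0 :=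
        Finset.sum_eq_zero fun i _ => by rw [hs.iteratedFDeriv i _ h2, norm_zero]
      rw [this, mul_zero]
      positivity
  have h3 := h1.trans (mul_le_mul_right h2 _)
  rw [← ENNReal.ofReal_mul hC.le, ENNReal.ofReal_le_ofReal_iff (by positivity)] at h3
  exact h3

end Functional

section RingAux
variable {R : Type*} [Ring R]

lemma ringAux_comm {a b : R} (h : Commute a b) : Commute (1 - a) (1 - b) :=
  (Commute.one_left _).sub_left ((Commute.one_right _).sub_right h)

lemma ringAux_R {a b : R} (h : Commute a b) (L : ℕ) :
    (1 - a) ^ (L + 1) - (1 - b) ^ (L + 1)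
      = (b - a) * ∑ i ∈ Finset.range (L + 1), (1 - a) ^ i * (1 - b) ^ (L + 1 - 1 - i) := by
  rw [← (ringAux_comm h).mul_geom_sum₂, _root_.sub_sub_sub_cancel_left]

lemma ringAux_S (a : R) (L : ℕ) :
    1 - (1 - a) ^ (L + 1) = a * ∑ i ∈ Finset.range (L + 1), (1 - a) ^ i := by
  rw [← mul_neg_geom_sum, _root_.sub_sub_cancel]

lemma ringAux_C {a c : R} (h : Commute c a) (L : ℕ) :
    Commute c (∑ i ∈ Finset.range (L + 1), (1 - a) ^ i) :=
  Commute.sum_right _ _ _ fun i _ => Commute.pow_right ((Commute.one_right _).sub_right h) i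

end RingAux

section Operators
variable {n : ℕ}

/-- bound on the `l`-th derivative -/
def DB {n : ℕ} (l : ℕ) (B : ℝ) (u : (Fin n → ℝ) → ℝ) : Prop :=
  ∀ x, ‖iteratedFDeriv ℝ l u x‖ ≤ B

lemma DB.mono {l : ℕ} {B B' : ℝ} {u : (Fin n → ℝ) → ℝ} (h : DB l B u) (hB : B ≤ B') :
    DB l B' u := fun x => (h x).trans hB

lemma DB.abs_le {B : ℝ} {u : (Fin n → ℝ) → ℝ} (h : DB 0 B u) (x : Fin n → ℝ) : |u x| ≤ B := by
  have := h x
  rwa [norm_iteratedFDeriv_zero] at this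

lemma Subtype.test (g : TD n) : IsTestFun n g.1 := g.2

lemma Subtype.contDiffAt (g : TD n) (i : ℕ) (x : Fin n → ℝ) : ContDiffAt ℝ i g.1 x :=
  (g.test.1.of_le (by exact_mod_cast le_top)).contDiffAt

lemma DB.add {l : ℕ} {B B' : ℝ} {u v : TD n} (hu : DB l B u.1) (hv : DB l B' v.1) :
    DB l (B + B') (u + v).1 := fun x => by
  have := iteratedFDeriv_add_apply (𝕜 := ℝ) (u.contDiffAt l x) (v.contDiffAt l x)
  change ‖iteratedFDeriv ℝ l (u.1 + v.1) x‖ ≤ _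
  rw [this]
  exact (norm_add_le _ _).trans (add_le_add (hu x) (hv x))

lemma iteratedFDeriv_subTD (l : ℕ) (u v : TD n) (x : Fin n → ℝ) :
    iteratedFDeriv ℝ l (u - v).1 x = iteratedFDeriv ℝ l u.1 x - iteratedFDeriv ℝ l v.1 x := by
  have h := iteratedFDeriv_add_apply (𝕜 := ℝ) ((u - v).contDiffAt l x) (v.contDiffAt l x)
  have h2 : (u - v).1 + v.1 = u.1 := by
    ext; simp
  rw [h2] at h
  rw [h]; simp

lemma DB.sub {l : ℕ} {B B' : ℝ} {u v : TD n} (hu : DB l B u.1) (hv : DB l B' v.1) :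
    DB l (B + B') (u - v).1 := fun x => by
  rw [iteratedFDeriv_subTD]
  exact (norm_sub_le _ _).trans (add_le_add (hu x) (hv x))

lemma DB.sum {l : ℕ} {B : ℝ} (s : Finset ℕ) {u : ℕ → TD n} (hu : ∀ i ∈ s, DB l B (u i).1) :
    DB l (s.card * B) (∑ i ∈ s, u i).1 := by
  classical
  induction s using Finset.induction_on with
  | empty =>
    intro x
    simp only [Finset.sum_empty, Finset.card_empty, CharP.cast_eq_zero, zero_mul]
    change ‖iteratedFDeriv ℝ l (0 : (Fin n → ℝ) → ℝ) x‖ ≤ 0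
    rw [iteratedFDeriv_zero]; simp
  | insert a s ha ih =>
    rw [Finset.sum_insert ha, Finset.card_insert_of_notMem ha]
    have h1 := (hu a (Finset.mem_insert_self a s)).add
      (ih fun i hi => hu i (Finset.mem_insert_of_mem hi))
    refine h1.mono (le_of_eq ?_)
    push_cast; ring

lemma SuppB.addTD {ρ : ℝ} {u v : TD n} (hu : SuppB ρ u.1) (hv : SuppB ρ v.1) :
    SuppB ρ (u + v).1 := fun x hx => by
  change u.1 x + v.1 x = 0
  rw [hu x hx, hv x hx, add_zero]

lemma SuppB.subTD {ρ : ℝ} {u v : TD n} (hu : SuppB ρ u.1) (hv : SuppB ρ v.1) :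
    SuppB ρ (u - v).1 := fun x hx => by
  change u.1 x - v.1 x = 0
  rw [hu x hx, hv x hx, sub_zero]

lemma SuppB.sumTD {ρ : ℝ} (s : Finset ℕ) {u : ℕ → TD n} (hu : ∀ i ∈ s, SuppB ρ (u i).1) :
    SuppB ρ (∑ i ∈ s, u i).1 := by
  classical
  induction s using Finset.induction_on with
  | empty => intro x _; rfl
  | insert a s ha ih =>
    rw [Finset.sum_insert ha]
    exact (hu a (Finset.mem_insert_self a s)).addTD
      (ih fun i hi => hu i (Finset.mem_insert_of_mem hi))

/-- convolution operator on test functions -/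
def opA (u : TD n) : Module.End ℝ (TD n) where
  toFun g := ⟨cvl u.1 g.1, u.test.cvl g.test⟩
  map_add' := fun g h => Subtype.ext
    (cvl_add u.1 u.test.1.continuous u.test.2 g.test.1.continuous h.test.1.continuous)
  map_smul' := fun c g => Subtype.ext (cvl_smul c u.1 g.1)

lemma opA_coe (u g : TD n) : (opA u g).1 = cvl u.1 g.1 := rfl

lemma opA_swap (u g : TD n) : opA u g = opA g u := Subtype.ext (cvl_comm _ _)

lemma opA_commute (u v : TD n) : Commute (opA u) (opA v) := by
  refine LinearMap.ext fun g => Subtype.ext ?_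
  change cvl u.1 (cvl v.1 g.1) = cvl v.1 (cvl u.1 g.1)
  rw [← cvl_assoc u.test.1.continuous u.test.2 v.test.1.continuous v.test.2
    g.test.1.continuous g.test.2, ← cvl_assoc v.test.1.continuous v.test.2
    u.test.1.continuous u.test.2 g.test.1.continuous g.test.2, cvl_comm u.1]

lemma opA_sub (u v : TD n) : opA (u - v) = opA u - opA v := by
  refine LinearMap.ext fun g => ?_
  rw [LinearMap.sub_apply, opA_swap, map_sub, opA_swap g, opA_swap g]

lemma SuppB.opA {a b : ℝ} {u g : TD n} (hu : SuppB a u.1) (hg : SuppB b g.1) :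
    SuppB (a + b) (opA u g).1 := by
  intro x hx
  rw [opA_coe, cvl]
  refine (integral_congr_ae (Eventually.of_forall fun y => ?_)).trans (integral_zero _ _)
  by_cases hy : a < ‖y‖
  · simp [hu y hy]
  · have : b < ‖x - y‖ := by
      have := norm_sub_norm_le x y
      linarith
    simp [hg _ this]

/-- dilates as a function -/
def Gfun (φ₀ : (Fin n → ℝ) → ℝ) (k : ℕ) (x : Fin n → ℝ) : ℝ :=
  (2 : ℝ) ^ (k * n) * φ₀ ((2 : ℝ) ^ k • x)

lemma Gfun_suppB {φ₀ : (Fin n → ℝ) → ℝ} {c : ℝ} (hc : 0 < c) (hs : SuppB c φ₀) (k : ℕ) :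
    SuppB (c * (1 / 2) ^ k) (Gfun φ₀ k) := by
  intro x hx
  rw [Gfun, hs, mul_zero]
  rw [norm_smul, norm_pow, Real.norm_ofNat]
  rw [one_div, inv_pow, ← div_eq_mul_inv, div_lt_iff₀ (by positivity)] at hx
  linarith

lemma Gfun_test {φ₀ : (Fin n → ℝ) → ℝ} (h : IsTestFun n φ₀) (k : ℕ) :
    IsTestFun n (Gfun φ₀ k) := by
  obtain ⟨c, hc, hs⟩ := h.exists_suppB
  exact ⟨contDiff_const.mul (h.1.comp (contDiff_const_smul _)),
    (Gfun_suppB hc hs k).hasCompactSupport⟩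

/-- dilates as test functions -/
def GT (φ : TD n) (k : ℕ) : TD n := ⟨Gfun φ.1 k, Gfun_test φ.test k⟩

lemma GT_DB {φ : TD n} {l : ℕ} {B : ℝ} (hB : DB l B φ.1) (k : ℕ) :
    DB l (2 ^ (k * n) * 2 ^ (k * l) * B) (GT φ k).1 := by
  intro x
  have h1 : ContDiff ℝ l φ.1 := φ.test.1.of_le (by exact_mod_cast le_top)
  have h2 := congrFun (iteratedFDeriv_comp_const_smul ((2 : ℝ) ^ k) h1) x
  have h3 : ContDiffAt ℝ l (fun z => φ.1 ((2 : ℝ) ^ k • z)) x :=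
    (h1.comp (contDiff_const_smul _)).contDiffAt
  have h4 := iteratedFDeriv_const_smul_apply (a := (2 : ℝ) ^ (k * n)) h3
  have h5 : (GT φ k).1 = (2 : ℝ) ^ (k * n) • (fun z => φ.1 ((2 : ℝ) ^ k • z)) := by
    ext; rfl
  rw [h5, h4, h2, norm_smul, norm_smul, ← pow_mul, norm_pow, norm_pow, Real.norm_ofNat, mul_assoc]
  gcongr
  exact hB _

lemma GT_integral_comp (ψ : (Fin n → ℝ) → ℝ) (k : ℕ) :
    ∫ x, (2 : ℝ) ^ (k * n) * ψ ((2 : ℝ) ^ k • x) = ∫ x, ψ x := by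
  rw [integral_const_mul, Measure.integral_comp_smul]
  simp only [Module.finrank_fintype_fun_eq_card, Fintype.card_fin, smul_eq_mul]
  rw [abs_of_pos (by positivity), ← pow_mul, ← mul_assoc, mul_inv_cancel₀ (by positivity), one_mul]

lemma GT_integral (φ : TD n) (k : ℕ) : ∫ x, (GT φ k).1 x = ∫ x, φ.1 x :=
  GT_integral_comp φ.1 k

lemma GT_integral_abs (φ : TD n) (k : ℕ) : ∫ x, |(GT φ k).1 x| = ∫ x, |φ.1 x| := by
  rw [← GT_integral_comp (fun x => |φ.1 x|) k]
  congr 1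
  ext x
  change |(2 : ℝ) ^ (k * n) * _| = _
  rw [abs_mul, abs_of_pos (by positivity)]

/-- identity minus convolution with the dilate -/
def opE (φ : TD n) (k : ℕ) : Module.End ℝ (TD n) := 1 - opA (GT φ k)

lemma opE_commute (φ : TD n) (k l : ℕ) : Commute (opE φ k) (opE φ l) := by
  exact ringAux_comm (R := Module.End ℝ (TD n)) (opA_commute _ _)

lemma opE_suppB {φ : TD n} {c ρ : ℝ} (hc : 0 < c) (hs : SuppB c φ.1) (k : ℕ) {g : TD n}
    (hg : SuppB ρ g.1) : SuppB (ρ + c) (opE φ k g).1 := by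
  have h1 : SuppB c (GT φ k).1 := (Gfun_suppB hc hs k).mono (by
    have : (1 / 2 : ℝ) ^ k ≤ 1 := pow_le_one₀ (by norm_num) (by norm_num)
    nlinarith)
  have h2 : opE φ k g = g - opA (GT φ k) g := rfl
  rw [h2]
  exact (hg.mono (by linarith)).subTD ((h1.opA hg).mono (by linarith))

lemma opE_DB_gen {φ : TD n} (hint : ∫ x, φ.1 x = 1) (k l : ℕ) {g : TD n} {b : ℝ}
    (hb : ∀ x y, (GT φ k).1 y ≠ 0 →
      ‖iteratedFDeriv ℝ l g.1 x - iteratedFDeriv ℝ l g.1 (x - y)‖ ≤ b) :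
    DB l ((∫ x, |φ.1 x|) * b) (opE φ k g).1 := by
  intro x
  have h2 : opE φ k g = g - opA (GT φ k) g := rfl
  have ht := (GT φ k).test
  rw [h2, iteratedFDeriv_subTD, opA_coe,
    cvl_iteratedFDeriv l ht.1.continuous ht.2 g.test.1 g.test.2]
  have hI : Integrable (GT φ k).1 := ht.1.continuous.integrable_of_hasCompactSupport ht.2
  have h3 : iteratedFDeriv ℝ l g.1 x = ∫ y, (GT φ k).1 y • iteratedFDeriv ℝ l g.1 x := by
    rw [integral_smul_const, GT_integral, hint, one_smul]
  rw [h3, cvl, ← integral_sub (hI.smul_const _)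
    (cvl_integrable ht.1.continuous ht.2 (g.test.iterated_continuous l) x)]
  rw [← GT_integral_abs φ k, ← integral_mul_const]
  refine norm_integral_le_of_norm_le (hI.abs.mul_const b) (Eventually.of_forall fun y => ?_)
  rw [← smul_sub, norm_smul, Real.norm_eq_abs]
  by_cases hy : (GT φ k).1 y = 0
  · simp [hy]
  · exact mul_le_mul_of_nonneg_left (hb x y hy) (abs_nonneg _)

lemma opE_DB {φ : TD n} (hint : ∫ x, φ.1 x = 1) {c : ℝ} (hc : 0 < c) (hs : SuppB c φ.1)
    (k l : ℕ) {g : TD n} {B : ℝ} (hB0 : 0 ≤ B)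
    (hB : DB (l + 1) B g.1) : DB l ((∫ x, |φ.1 x|) * c * (1 / 2) ^ k * B) (opE φ k g).1 := by
  have := opE_DB_gen hint k l (g := g) (b := B * (c * (1 / 2) ^ k)) (fun x y hy => by
    have h1 := g.test.lip l hB x (x - y)
    rw [_root_.sub_sub_cancel] at h1
    refine h1.trans (mul_le_mul_of_nonneg_left ?_ hB0)
    by_contra h
    exact hy (Gfun_suppB hc hs k y (not_le.1 h)))
  exact this.mono (le_of_eq (by ring))

lemma opE_DB' {φ : TD n} (hint : ∫ x, φ.1 x = 1) (k l : ℕ) {g : TD n} {B : ℝ}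
    (hB : DB l B g.1) : DB l ((2 * ∫ x, |φ.1 x|) * B) (opE φ k g).1 := by
  have := opE_DB_gen hint k l (g := g) (b := B + B) (fun x y hy =>
    (norm_sub_le _ _).trans (add_le_add (hB _) (hB _)))
  exact this.mono (le_of_eq (by ring))

lemma one_le_I {φ : TD n} (hint : ∫ x, φ.1 x = 1) : 1 ≤ ∫ x, |φ.1 x| := by
  have := abs_integral_le_integral_abs (f := φ.1) (μ := volume)
  rwa [hint, abs_one] at this

lemma opE_pow_suppB {φ : TD n} {c ρ : ℝ} (hc : 0 < c) (hs : SuppB c φ.1) (k i : ℕ) {g : TD n}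
    (hg : SuppB ρ g.1) : SuppB (ρ + i * c) ((opE φ k ^ i) g).1 := by
  induction i with
  | zero => simpa using hg
  | succ i ih =>
    rw [pow_succ' (opE φ k) i, Module.End.mul_apply]
    exact (opE_suppB hc hs k ih).mono (by push_cast; linarith)

lemma opE_pow_DB {φ : TD n} (hint : ∫ x, φ.1 x = 1) {c : ℝ} (hc : 0 < c) (hs : SuppB c φ.1)
    (k i : ℕ) : ∀ (l : ℕ) {g : TD n} {B : ℝ} (_ : 0 ≤ B)
    (_ : DB (l + i) B g.1),
      DB l (((∫ x, |φ.1 x|) * c * (1 / 2) ^ k) ^ i * B) ((opE φ k ^ i) g).1 := by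
  have hI := one_le_I hint
  induction i with
  | zero => intro l g B _ h; simpa using h
  | succ i ih =>
    intro l g B hB0 h
    rw [pow_succ' (opE φ k) i, Module.End.mul_apply]
    have h1 := ih (l + 1) hB0 (by rwa [add_assoc, add_comm 1 i])
    refine (opE_DB hint hc hs k l ?_ h1).mono (le_of_eq (by ring))
    positivity

lemma opE_pow_DB' {φ : TD n} (hint : ∫ x, φ.1 x = 1)
    (k i l : ℕ) {g : TD n} {B : ℝ} (hB : DB l B g.1) :
      DB l ((2 * ∫ x, |φ.1 x|) ^ i * B) ((opE φ k ^ i) g).1 := by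
  induction i with
  | zero => simpa using hB
  | succ i ih =>
    rw [pow_succ' (opE φ k) i, Module.End.mul_apply]
    exact (opE_DB' hint k l ih).mono (le_of_eq (by ring))

/-- the remainder operator -/
def opR (φ : TD n) (L m : ℕ) : Module.End ℝ (TD n) :=
  ∑ i ∈ Finset.range (L + 1), opE φ m ^ i * opE φ (m + 1) ^ (L + 1 - 1 - i)

/-- the initial operator -/
def opS (φ : TD n) (L j : ℕ) : Module.End ℝ (TD n) :=
  ∑ i ∈ Finset.range (L + 1), opE φ j ^ i

lemma opR_identity (φ : TD n) (L m : ℕ) :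
    opE φ m ^ (L + 1) - opE φ (m + 1) ^ (L + 1)
      = opA (GT φ (m + 1) - GT φ m) * opR φ L m := by
  rw [opA_sub]
  exact ringAux_R (R := Module.End ℝ (TD n)) (opA_commute _ _) L

lemma opS_identity (φ : TD n) (L j : ℕ) :
    1 - opE φ j ^ (L + 1) = opA (GT φ j) * opS φ L j := by
  exact ringAux_S (R := Module.End ℝ (TD n)) _ L

lemma opS_commute (φ u : TD n) (L j : ℕ) : Commute (opA u) (opS φ L j) := by
  exact ringAux_C (R := Module.End ℝ (TD n)) (opA_commute _ _) L

lemma opR_suppB {φ : TD n} {c ρ : ℝ} (hc : 0 < c) (hs : SuppB c φ.1) (L m : ℕ) {g : TD n}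
    (hg : SuppB ρ g.1) : SuppB (ρ + L * c) (opR φ L m g).1 := by
  rw [opR, LinearMap.sum_apply]
  refine SuppB.sumTD _ fun i hi => ?_
  rw [Module.End.mul_apply]
  refine (opE_pow_suppB hc hs m i (opE_pow_suppB hc hs (m + 1) _ hg)).mono (le_of_eq ?_)
  have : i ≤ L := by simpa [Nat.lt_succ_iff] using hi
  rw [Nat.add_sub_cancel, Nat.cast_sub this]
  ring

lemma opS_suppB {φ : TD n} {c ρ : ℝ} (hc : 0 < c) (hs : SuppB c φ.1) (L m : ℕ) {g : TD n}
    (hg : SuppB ρ g.1) : SuppB (ρ + L * c) (opS φ L m g).1 := by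
  rw [opS, LinearMap.sum_apply]
  refine SuppB.sumTD _ fun i hi => ?_
  refine (opE_pow_suppB hc hs m i hg).mono ?_
  have : (i : ℝ) ≤ L := by
    have : i ≤ L := by simpa [Nat.lt_succ_iff] using hi
    exact_mod_cast this
  nlinarith

lemma opR_DB {φ : TD n} (hint : ∫ x, φ.1 x = 1) {c : ℝ} (hc : 0 < c) (hs : SuppB c φ.1)
    (L m : ℕ) {g : TD n} {B : ℝ} (hB0 : 0 ≤ B) (hB : DB L B g.1) :
    DB 0 ((L + 1) * (((∫ x, |φ.1 x|) * c * (1 / 2) ^ m) ^ L * B)) (opR φ L m g).1 := by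
  have hI := one_le_I hint
  rw [opR, LinearMap.sum_apply]
  have := DB.sum (l := 0) (B := ((∫ x, |φ.1 x|) * c * (1 / 2) ^ m) ^ L * B)
    (Finset.range (L + 1))
    (u := fun i => (opE φ m ^ i * opE φ (m + 1) ^ (L + 1 - 1 - i)) g) (fun i hi => ?_)
  · simpa using this
  · have hiL : i ≤ L := by simpa [Nat.lt_succ_iff] using hi
    rw [Module.End.mul_apply, Nat.add_sub_cancel]
    have h1 := opE_pow_DB hint hc hs (m + 1) (L - i) i hB0
      (by rwa [Nat.add_sub_cancel' hiL])
    have hI0 : 0 ≤ ∫ x, |φ.1 x| := by linarith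
    have h2 := opE_pow_DB hint hc hs m i 0 (g := (opE φ (m + 1) ^ (L - i)) g)
      (B := ((∫ x, |φ.1 x|) * c * (1 / 2) ^ (m + 1)) ^ (L - i) * B)
      (by positivity) (by rw [zero_add]; exact h1)
    refine h2.mono ?_
    have h3 : (1 / 2 : ℝ) ^ (m + 1) ≤ (1 / 2) ^ m :=
      pow_le_pow_of_le_one (by norm_num) (by norm_num) (Nat.le_succ m)
    calc _ ≤ ((∫ x, |φ.1 x|) * c * (1 / 2) ^ m) ^ i *
          (((∫ x, |φ.1 x|) * c * (1 / 2) ^ m) ^ (L - i) * B) := by gcongr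
      _ = _ := by rw [← mul_assoc, ← pow_add, Nat.add_sub_cancel' hiL]

lemma opS_DB {φ : TD n} (hint : ∫ x, φ.1 x = 1)
    (L j l : ℕ) {g : TD n} {B : ℝ} (hB0 : 0 ≤ B) (hB : DB l B g.1) :
    DB l ((L + 1) * ((2 * ∫ x, |φ.1 x|) ^ L * B)) (opS φ L j g).1 := by
  have hI := one_le_I hint
  rw [opS, LinearMap.sum_apply]
  have := DB.sum (l := l) (B := (2 * ∫ x, |φ.1 x|) ^ L * B)
    (Finset.range (L + 1))
    (u := fun i => (opE φ j ^ i) g) (fun i hi => ?_)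
  · simpa using this
  · have hiL : i ≤ L := by simpa [Nat.lt_succ_iff] using hi
    refine (opE_pow_DB' hint j i l hB).mono ?_
    gcongr
    linarith

/-- the family `φ_k` as test functions -/
def PT (φ : TD n) : ℕ → TD n
  | 0 => GT φ 0
  | k + 1 => GT φ (k + 1) - GT φ k

lemma PT_coe (φ : TD n) (k : ℕ) : (PT φ k).1 = phiFam n φ.1 k := by
  cases k with
  | zero => ext x; simp [PT, GT, Gfun, phiFam]
  | succ k =>
    ext x
    change (2 : ℝ) ^ ((k + 1) * n) * φ.1 ((2 : ℝ) ^ (k + 1) • x)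
      - (2 : ℝ) ^ (k * n) * φ.1 ((2 : ℝ) ^ k • x) = (2 : ℝ) ^ ((k + 1) * n) *
        (φ.1 ((2 : ℝ) ^ (k + 1) • x) - (2 : ℝ)⁻¹ ^ n * φ.1 ((2 : ℝ)⁻¹ • ((2 : ℝ) ^ (k + 1) • x)))
    have h1 : (2 : ℝ)⁻¹ • ((2 : ℝ) ^ (k + 1) • x) = (2 : ℝ) ^ k • x := by
      rw [smul_smul, pow_succ]; congr 1; field_simp
    have h2 : (2 : ℝ) ^ ((k + 1) * n) * (2 : ℝ)⁻¹ ^ n = 2 ^ (k * n) := by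
      rw [add_mul, one_mul, pow_add, inv_pow, mul_assoc, mul_inv_cancel₀ (by positivity), mul_one]
    rw [h1, mul_sub, ← mul_assoc _ ((2 : ℝ)⁻¹ ^ n), h2]

lemma GT_suppB {φ : TD n} {c : ℝ} (hc : 0 < c) (hs : SuppB c φ.1) (k : ℕ) :
    SuppB c (GT φ k).1 := (Gfun_suppB hc hs k).mono (by
    have : (1 / 2 : ℝ) ^ k ≤ 1 := pow_le_one₀ (by norm_num) (by norm_num)
    nlinarith)

lemma PT_suppB {φ : TD n} {c : ℝ} (hc : 0 < c) (hs : SuppB c φ.1) (k : ℕ) :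
    SuppB c (PT φ k).1 := by
  cases k with
  | zero => exact GT_suppB hc hs 0
  | succ k => exact (GT_suppB hc hs _).subTD (GT_suppB hc hs _)

lemma PT_DB {φ : TD n} {l : ℕ} {B : ℝ} (hB0 : 0 ≤ B) (hB : DB l B φ.1) (k : ℕ) :
    DB l (2 * (2 ^ (k * n) * 2 ^ (k * l) * B)) (PT φ k).1 := by
  cases k with
  | zero => exact (GT_DB hB 0).mono (by
      have : 0 ≤ (2 : ℝ) ^ (0 * n) * 2 ^ (0 * l) * B := by positivity
      linarith)
  | succ k =>
    refine ((GT_DB hB (k + 1)).sub (GT_DB hB k)).mono ?_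
    rw [two_mul]
    gcongr <;> first | exact one_le_two | exact Nat.le_succ k

end Operators

section Repr
variable {n : ℕ}

/-- evaluation of the convolution with a distribution as a linear map -/
def dcL (f : Dstrb n) (x : Fin n → ℝ) : TD n →ₗ[ℝ] ℝ where
  toFun g := distConv n f g.1 x
  map_add' := fun g h => f.map_add (fun y => g.1 (x - y)) (fun y => h.1 (x - y))
  map_smul' := fun c g => f.map_smul c (fun y => g.1 (x - y))

lemma dcL_apply (f : Dstrb n) (x : Fin n → ℝ) (g : TD n) : dcL f x g = distConv n f g.1 x := rfl

/-- local integrals -/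
def JB (f : Dstrb n) (u : TD n) (x : Fin n → ℝ) (r : ℝ) : ℝ≥0∞ :=
  ∫⁻ z in Metric.closedBall x r, ‖distConv n f u.1 z‖ₑ

lemma conv_bound {f : Dstrb n} (hf : MemSe' n f) (u h : TD n) {B ρ : ℝ}
    (hB : DB 0 B h.1) (hs : SuppB ρ h.1) (x : Fin n → ℝ) :
    ‖dcL f x (opA u h)‖ₑ ≤ ENNReal.ofReal B * JB f u x ρ := by
  rw [opA_swap, dcL_apply, opA_coe, distConv_cvl hf h.test u.test]
  refine (enorm_integral_le_lintegral_enorm _).trans ?_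
  rw [← lintegral_sub_left_eq_self _ x, JB, ← lintegral_const_mul' _ _ ENNReal.ofReal_ne_top,
    ← lintegral_indicator Metric.isClosed_closedBall.measurableSet]
  refine lintegral_mono fun z => ?_
  simp only [_root_.sub_sub_cancel]
  by_cases hz : z ∈ Metric.closedBall x ρ
  · rw [Set.indicator_of_mem hz, enorm_mul]
    gcongr
    rw [Real.enorm_eq_ofReal_abs]
    exact ENNReal.ofReal_le_ofReal (hB.abs_le _)
  · rw [hs, zero_mul, enorm_zero]
    · exact zero_le
    · rw [Metric.mem_closedBall, dist_comm, dist_eq_norm] at hz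
      exact not_le.1 hz

lemma telescope (φ : TD n) (L j K : ℕ) (g : TD n) :
    g = opA (GT φ j) (opS φ L j g)
      + ∑ m ∈ Finset.range K, opA (PT φ (j + m + 1)) (opR φ L (j + m) g)
      + (opE φ (j + K) ^ (L + 1)) g := by
  induction K with
  | zero =>
    have h := congrArg (fun T => T g) (opS_identity φ L j)
    simp only [LinearMap.sub_apply, Module.End.mul_apply, Module.End.one_apply] at h
    rw [← h]; simp
  | succ K ih =>
    have h := congrArg (fun T => T g) (opR_identity φ L (j + K))
    simp only [LinearMap.sub_apply, Module.End.mul_apply] at h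
    have h3 : PT φ (j + K + 1) = GT φ (j + K + 1) - GT φ (j + K) := rfl
    rw [Finset.sum_range_succ, h3, ← h]
    conv_lhs => rw [ih]
    rw [← add_assoc j K 1]
    abel

lemma remainder_tendsto {f : Dstrb n} (hf : MemSe' n f) {φ : TD n} (hint : ∫ x, φ.1 x = 1)
    (L j : ℕ) (g : TD n) (x : Fin n → ℝ) :
    Tendsto (fun K => ‖dcL f x ((opE φ (j + K) ^ (L + 1)) g)‖ₑ) atTop (𝓝 0) := by
  obtain ⟨C, N, hC, h⟩ := hf
  obtain ⟨c, hc, hs⟩ := φ.test.exists_suppB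
  obtain ⟨ρ, hρ, hg⟩ := g.test.exists_suppB
  choose b hb0 hb using fun i => g.test.exists_bound i
  have hI := one_le_I hint
  set I := ∫ x, |φ.1 x| with hIdef
  have hI0 : 0 ≤ I := by linarith
  set B : ℝ := ∑ i ∈ Finset.range (N + 2), b i with hB
  have hB0 : 0 ≤ B := Finset.sum_nonneg fun i _ => hb0 i
  have hbB : ∀ i ≤ N + 1, b i ≤ B := fun i hi =>
    Finset.single_le_sum (f := b) (fun i _ => hb0 i) (Finset.mem_range.2 (by omega))
  have key : ∀ K, |dcL f x ((opE φ (j + K) ^ (L + 1)) g)| ≤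
      (C * (Real.exp (N * (‖x‖ + (ρ + (L + 1 : ℕ) * c))) * ((N + 1) *
        (I * c * ((2 * I) ^ L * B))))) * (1 / 2) ^ (j + K) := by
    intro K
    refine (distConv_apriori hC h ((opE φ (j + K) ^ (L + 1)) g).test (B := I * c * (1 / 2) ^ (j + K) * ((2 * I) ^ L * B))
      (by positivity) (opE_pow_suppB hc hs (j + K) (L + 1) hg) (fun i hi => ?_) x).trans
      (le_of_eq (by ring))
    rw [pow_succ' (opE φ (j + K)) L, Module.End.mul_apply]
    refine opE_DB hint hc hs (j + K) i (by positivity) ?_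
    exact opE_pow_DB' hint _ L (i + 1) (DB.mono (fun z => hb (i + 1) z) (hbB _ (by omega)))
  have h0 : Tendsto (fun K : ℕ => (C * (Real.exp (N * (‖x‖ + (ρ + (L + 1 : ℕ) * c))) * ((N + 1) *
        (I * c * ((2 * I) ^ L * B))))) * (1 / 2 : ℝ) ^ (j + K)) atTop (𝓝 0) := by
    have h1 : Tendsto (fun K : ℕ => (1 / 2 : ℝ) ^ (j + K)) atTop (𝓝 0) := by
      have := (tendsto_pow_atTop_nhds_zero_of_lt_one (r := (1 / 2 : ℝ)) (by norm_num)
        (by norm_num)).comp (tendsto_add_atTop_nat j)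
      refine this.congr fun K => ?_
      simp [add_comm]
    simpa using h1.const_mul (C * (Real.exp (N * (‖x‖ + (ρ + (L + 1 : ℕ) * c))) * ((N + 1) *
        (I * c * ((2 * I) ^ L * B)))))
  have h1 := squeeze_zero (fun K => abs_nonneg _) key h0
  have h2 := ENNReal.tendsto_ofReal h1
  rw [ENNReal.ofReal_zero] at h2
  refine h2.congr fun K => ?_
  rw [Real.enorm_eq_ofReal_abs]

lemma rep_gen {f : Dstrb n} (hf : MemSe' n f) {φ : TD n} (hint : ∫ x, φ.1 x = 1)
    {c : ℝ} (hc : 0 < c) (hs : SuppB c φ.1) (L j : ℕ) {g : TD n} {ρ B : ℝ}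
    (hg : SuppB ρ g.1) (hB0 : 0 ≤ B) (hB : DB L B g.1) (x : Fin n → ℝ) :
    ‖dcL f x g‖ₑ ≤ ‖dcL f x (opA (GT φ j) (opS φ L j g))‖ₑ +
      ∑' m, ENNReal.ofReal ((L + 1) * (((∫ x, |φ.1 x|) * c * (1 / 2) ^ (j + m)) ^ L * B)) *
        JB f (PT φ (j + m + 1)) x (ρ + L * c) := by
  set Z := ‖dcL f x (opA (GT φ j) (opS φ L j g))‖ₑ
  set T : ℕ → ℝ≥0∞ := fun m =>
    ENNReal.ofReal ((L + 1) * (((∫ x, |φ.1 x|) * c * (1 / 2) ^ (j + m)) ^ L * B)) *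
        JB f (PT φ (j + m + 1)) x (ρ + L * c)
  have hK : ∀ K, ‖dcL f x g‖ₑ ≤ Z + ∑' m, T m + ‖dcL f x ((opE φ (j + K) ^ (L + 1)) g)‖ₑ := by
    intro K
    conv_lhs => rw [telescope φ L j K g]
    rw [map_add, map_add, map_sum]
    refine (enorm_add_le _ _).trans (add_le_add ((enorm_add_le _ _).trans
      (add_le_add le_rfl ?_)) le_rfl)
    refine (enorm_sum_le _ _).trans ?_
    refine le_trans (Finset.sum_le_sum fun m _ => ?_) (ENNReal.sum_le_tsum (Finset.range K))
    exact conv_bound hf _ _ (opR_DB hint hc hs L (j + m) hB0 hB) (opR_suppB hc hs L _ hg) x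
  have hlim := (remainder_tendsto hf hint L j g x).const_add (Z + ∑' m, T m)
  rw [add_zero] at hlim
  exact ge_of_tendsto' hlim hK

lemma rep1 {φ : TD n} (hint : ∫ x, φ.1 x = 1) (L : ℕ) :
    ∃ C c : ℝ, 0 < C ∧ 0 < c ∧ ∀ f : Dstrb n, MemSe' n f → ∀ (j : ℕ) (x : Fin n → ℝ),
      ‖distConv n f (PT φ j).1 x‖ₑ ≤
        ∑' k : ℕ, ENNReal.ofReal (C * (1 / 2) ^ (k * L) * 2 ^ (j * n)) *
          JB f (PT φ (j + k)) x c := by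
  obtain ⟨c, hc, hs⟩ := φ.test.exists_suppB
  obtain ⟨B0, hB00, hB0⟩ := φ.test.exists_bound 0
  obtain ⟨BL, hBL0, hBL⟩ := φ.test.exists_bound L
  have hI := one_le_I hint
  set I := ∫ x, |φ.1 x| with hIdef
  have hI0 : 0 ≤ I := by linarith
  set C : ℝ := (L + 1) * ((2 * I) ^ L * B0) + (L + 1) * ((I * c) ^ L * (2 * BL)) * 2 ^ L + 1
    with hC
  refine ⟨C, c + L * c, by positivity, by positivity, fun f hf j x => ?_⟩
  refine (rep_gen hf hint hc hs L j (PT_suppB hc hs j) (by positivity)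
    (PT_DB hBL0 (fun z => hBL z) j) x).trans ?_
  conv_rhs => rw [tsum_eq_zero_add' ENNReal.summable]
  refine add_le_add ?_ (ENNReal.tsum_le_tsum fun m => ?_)
  · have h1 : opA (GT φ j) (opS φ L j (PT φ j)) = opA (PT φ j) (opS φ L j (GT φ j)) := by
      have e1 := congrArg (fun T => T (PT φ j)) (opS_commute φ (GT φ j) L j).eq
      have e2 := congrArg (fun T => T (GT φ j)) (opS_commute φ (PT φ j) L j).eq
      simp only [Module.End.mul_apply] at e1 e2
      rw [e1, e2, opA_swap]
    rw [h1, add_zero]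
    refine (conv_bound hf _ _ (opS_DB hint L j 0 (by positivity)
      (GT_DB (fun z => hB0 z) j)) (opS_suppB hc hs L j (GT_suppB hc hs j)) x).trans ?_
    refine mul_le_mul' (ENNReal.ofReal_le_ofReal ?_) le_rfl
    rw [← hIdef]
    simp only [mul_zero, zero_mul, pow_zero, mul_one]
    have : (0 : ℝ) ≤ ((L + 1) * ((I * c) ^ L * (2 * BL)) * 2 ^ L + 1) * 2 ^ (j * n) := by positivity
    calc _ = (L + 1) * ((2 * I) ^ L * B0) * 2 ^ (j * n) := by ring
      _ ≤ _ := by rw [hC]; linarith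
  · rw [add_assoc]
    refine mul_le_mul' (ENNReal.ofReal_le_ofReal ?_) le_rfl
    rw [← hIdef]
    have e : (1 / 2 : ℝ) ^ (j + m) = (1 / 2) ^ j * (1 / 2) ^ m := pow_add _ _ _
    have e2 : ((1 / 2 : ℝ) ^ j) ^ L * 2 ^ (j * L) = 1 := by
      rw [← pow_mul, ← mul_pow]; norm_num
    have e3 : ((1 / 2 : ℝ) ^ m) ^ L = (1 / 2) ^ ((m + 1) * L) * 2 ^ L := by
      rw [add_mul, one_mul, pow_add, mul_assoc, ← mul_pow, ← pow_mul]; norm_num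
    have : (0 : ℝ) ≤ ((L + 1) * ((2 * I) ^ L * B0) + 1) * ((1 / 2) ^ ((m + 1) * L) * 2 ^ (j * n)) := by
      positivity
    calc _ = (L + 1) * ((I * c) ^ L * (2 * BL)) * ((1 / 2 : ℝ) ^ m) ^ L *
          (((1 / 2 : ℝ) ^ j) ^ L * 2 ^ (j * L)) * 2 ^ (j * n) := by rw [e]; ring
      _ = (L + 1) * ((I * c) ^ L * (2 * BL)) * 2 ^ L * ((1 / 2) ^ ((m + 1) * L) * 2 ^ (j * n)) := by
        rw [e2, e3]; ring
      _ ≤ _ := by rw [hC]; linarith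

lemma rep2 {φ : TD n} (hint : ∫ x, φ.1 x = 1) (L : ℕ) :
    ∃ C c : ℝ, 0 < C ∧ 0 < c ∧ ∀ f : Dstrb n, MemSe' n f → ∀ (θ : TD n) (B : ℝ), 0 ≤ B →
      SuppB 1 θ.1 → DB 0 B θ.1 → DB L B θ.1 → ∀ x : Fin n → ℝ,
      ‖distConv n f θ.1 x‖ₑ ≤
        ∑' k : ℕ, ENNReal.ofReal (C * (1 / 2) ^ (k * L) * B) * JB f (PT φ k) x c := by
  obtain ⟨c, hc, hs⟩ := φ.test.exists_suppB
  have hI := one_le_I hint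
  set I := ∫ x, |φ.1 x| with hIdef
  have hI0 : 0 ≤ I := by linarith
  set C : ℝ := (L + 1) * (2 * I) ^ L + (L + 1) * (I * c) ^ L * 2 ^ L + 1
    with hC
  refine ⟨C, 1 + L * c, by positivity, by positivity, fun f hf θ B hB0 hθ h0 hL x => ?_⟩
  refine (rep_gen hf hint hc hs L 0 hθ hB0 hL x).trans ?_
  conv_rhs => rw [tsum_eq_zero_add' ENNReal.summable]
  refine add_le_add ?_ (ENNReal.tsum_le_tsum fun m => ?_)
  · refine (conv_bound hf _ _ (opS_DB hint L 0 0 hB0 h0) (opS_suppB hc hs L 0 hθ) x).trans ?_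
    change _ * JB f (PT φ 0) x _ ≤ _
    refine mul_le_mul' (ENNReal.ofReal_le_ofReal ?_) le_rfl
    rw [← hIdef]
    simp only [zero_mul, pow_zero, mul_one]
    have : (0 : ℝ) ≤ ((L + 1) * (I * c) ^ L * 2 ^ L + 1) * B := by positivity
    calc _ = (L + 1) * (2 * I) ^ L * B := by ring
      _ ≤ _ := by rw [hC]; linarith
  · rw [zero_add]
    refine mul_le_mul' (ENNReal.ofReal_le_ofReal ?_) le_rfl
    rw [← hIdef]
    have e3 : ((1 / 2 : ℝ) ^ m) ^ L = (1 / 2) ^ ((m + 1) * L) * 2 ^ L := by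
      rw [add_mul, one_mul, pow_add, mul_assoc, ← mul_pow, ← pow_mul]; norm_num
    have : (0 : ℝ) ≤ ((L + 1) * (2 * I) ^ L + 1) * ((1 / 2) ^ ((m + 1) * L) * B) := by
      positivity
    calc _ = (L + 1) * (I * c) ^ L * ((1 / 2 : ℝ) ^ m) ^ L * B := by ring
      _ = (L + 1) * (I * c) ^ L * 2 ^ L * ((1 / 2) ^ ((m + 1) * L) * B) := by
        rw [e3]; ring
      _ ≤ _ := by rw [hC]; linarith

lemma apriori_PT {f : Dstrb n} (hf : MemSe' n f) (φ : TD n) :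
    ∃ (A : ℝ) (N : ℕ), 0 < A ∧ ∀ k (y : Fin n → ℝ),
      ‖distConv n f (PT φ k).1 y‖ₑ ≤
        ENNReal.ofReal (A * 2 ^ (k * (n + N)) * Real.exp (N * ‖y‖)) := by
  obtain ⟨C, N, hC, h⟩ := hf
  obtain ⟨c, hc, hs⟩ := φ.test.exists_suppB
  choose b hb0 hb using fun i => φ.test.exists_bound i
  set B : ℝ := ∑ i ∈ Finset.range (N + 1), b i with hB
  have hB0 : 0 ≤ B := Finset.sum_nonneg fun i _ => hb0 i
  have hbB : ∀ i ≤ N, b i ≤ B := fun i hi =>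
    Finset.single_le_sum (f := b) (fun i _ => hb0 i) (Finset.mem_range.2 (by omega))
  refine ⟨C * (Real.exp (N * c) * ((N + 1) * (2 * B))) + 1, N, by positivity, fun k y => ?_⟩
  rw [Real.enorm_eq_ofReal_abs]
  refine ENNReal.ofReal_le_ofReal ?_
  have h1 := distConv_apriori hC h (PT φ k).test (B := 2 * (2 ^ (k * n) * 2 ^ (k * N) * B))
    (by positivity) (PT_suppB hc hs k) (fun i hi => ?_) y
  · refine h1.trans ?_
    have e1 : Real.exp (N * (‖y‖ + c)) = Real.exp (N * c) * Real.exp (N * ‖y‖) := by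
      rw [← Real.exp_add]; ring_nf
    have e2 : (2 : ℝ) ^ (k * (n + N)) = 2 ^ (k * n) * 2 ^ (k * N) := by rw [← pow_add]; ring_nf
    rw [e1, e2]
    have : (0 : ℝ) ≤ 1 * (2 ^ (k * n) * 2 ^ (k * N)) * Real.exp (N * ‖y‖) := by positivity
    linarith
  · refine DB.mono (PT_DB hB0 (DB.mono (fun z => hb i z) (hbB i hi)) k) ?_
    gcongr
    · norm_num

end Repr

section Bootstrap
variable {n : ℕ}

/-- the exponential with values in `ℝ≥0∞` -/
def eE (t : ℝ) : ℝ≥0∞ := ENNReal.ofReal (Real.exp t)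

lemma eE_add (s t : ℝ) : eE (s + t) = eE s * eE t := by
  rw [eE, Real.exp_add, ENNReal.ofReal_mul (Real.exp_pos s).le]; rfl

lemma eE_zero : eE 0 = 1 := by simp [eE]

lemma eE_ne_zero (t : ℝ) : eE t ≠ 0 := by
  simp [eE, Real.exp_pos]

lemma eE_ne_top (t : ℝ) : eE t ≠ ∞ := ENNReal.ofReal_ne_top

lemma eE_mono {s t : ℝ} (h : s ≤ t) : eE s ≤ eE t :=
  ENNReal.ofReal_le_ofReal (Real.exp_le_exp.2 h)

lemma eE_rpow (t p : ℝ) : eE t ^ p = eE (t * p) := by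
  rw [eE, ENNReal.ofReal_rpow_of_pos (Real.exp_pos t), ← Real.exp_mul]; rfl

lemma eE_two (a : ℝ) : eE (a * Real.log 2) = ENNReal.ofReal (2 ^ a) := by
  rw [eE, Real.rpow_def_of_pos two_pos, mul_comm]

lemma eE_tsum_half : ∑' k : ℕ, eE (-((k : ℝ) * Real.log 2)) = 2 := by
  have : ∀ k : ℕ, eE (-((k : ℝ) * Real.log 2)) = (2⁻¹ : ℝ≥0∞) ^ k := by
    intro k
    rw [← neg_mul, eE_two, Real.rpow_neg two_pos.le, Real.rpow_natCast, ENNReal.ofReal_inv_of_pos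
      (by positivity), ENNReal.ofReal_pow two_pos.le, ENNReal.inv_pow]
    simp
  simp_rw [this]
  exact ENNReal.tsum_geometric_two

lemma split_rpow {a b : ℝ≥0∞} {r : ℝ} (hr : 0 < r) (hr1 : r ≤ 1) (h : a ≤ b) (ha : a ≠ ∞) :
    a ≤ a ^ r * b ^ (1 - r) := by
  have : a = a ^ r * a ^ (1 - r) := by
    rw [← ENNReal.rpow_add_of_nonneg _ _ hr.le (by linarith)]
    simp
  calc a = a ^ r * a ^ (1 - r) := this
    _ ≤ _ := by
      gcongr

lemma absorb {B Y : ℝ≥0∞} {r : ℝ} (hr : 0 < r) (hr1 : r ≤ 1) (hB : B ≠ ∞)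
    (h : B ≤ Y * B ^ (1 - r)) : B ^ r ≤ Y := by
  by_cases h0 : B = 0
  · rw [h0, ENNReal.zero_rpow_of_pos hr]; exact zero_le
  have e : B = B ^ r * B ^ (1 - r) := by
    rw [← ENNReal.rpow_add _ _ h0 hB]; simp
  have h1 : B ^ r * B ^ (1 - r) ≤ Y * B ^ (1 - r) := by rwa [← e]
  refine (ENNReal.mul_le_mul_iff_left ?_ ?_).1 h1
  · exact (ENNReal.rpow_pos (pos_iff_ne_zero.2 h0) hB).ne'
  · exact ENNReal.rpow_ne_top_of_nonneg (by linarith) hB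

lemma bootstrap0 (u : ℕ → (Fin n → ℝ) → ℝ≥0∞) {r c N L b : ℝ} (hr : 0 < r) (hr1 : r ≤ 1)
    (hc : 0 < c) (hN : 0 ≤ N) (hL : n + 1 + b ≤ r * L) {C A S : ℝ≥0∞} (hA : A ≠ ∞)
    (hm : ∀ k, Measurable (u k))
    (h1 : ∀ j x, u j x ≤ ∑' k : ℕ, C * eE ((j * n - k * L) * Real.log 2) *
      ∫⁻ z in Metric.closedBall x c, u (j + k) z)
    (h2 : ∀ k y, u k y ≤ A * eE (k * L * Real.log 2 + N * ‖y‖))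
    (h3 : ∀ k x, ∫⁻ z in Metric.closedBall x c, u k z ^ r ≤
      S * eE (k * b * Real.log 2 + N * r * ‖x‖)) :
    u 0 0 ^ r ≤ 2 * C * eE (N * c) * S := by
  set W : ℕ → (Fin n → ℝ) → ℝ≥0∞ := fun k y => eE (k * L * Real.log 2 + N * ‖y‖) with hW
  have hW0 : ∀ k y, W k y ≠ 0 := fun k y => eE_ne_zero _
  have hWt : ∀ k y, W k y ≠ ∞ := fun k y => eE_ne_top _
  set B : ℝ≥0∞ := ⨆ k, ⨆ y, u k y / W k y with hB
  have hBA : B ≤ A := iSup_le fun k => iSup_le fun y => ENNReal.div_le_of_le_mul (h2 k y)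
  have hBt : B ≠ ∞ := ne_top_of_le_ne_top hA hBA
  have huB : ∀ k y, u k y ≤ B * W k y := fun k y =>
    (ENNReal.div_le_iff (hW0 k y) (hWt k y)).1
      (le_iSup_of_le k (le_iSup (fun y => u k y / W k y) y))
  have hut : ∀ k y, u k y ≠ ∞ := fun k y =>
    ne_top_of_le_ne_top (ENNReal.mul_ne_top hBt (hWt k y)) (huB k y)
  have hlog : 0 < Real.log 2 := Real.log_pos one_lt_two
  have hr' : 0 ≤ 1 - r := by linarith
  have hI : ∀ k x, ∫⁻ z in Metric.closedBall x c, u k z ≤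
      B ^ (1 - r) * eE ((k * L * Real.log 2 + N * (‖x‖ + c)) * (1 - r)) *
        (S * eE (k * b * Real.log 2 + N * r * ‖x‖)) := by
    intro k x
    refine le_trans ?_ (mul_le_mul' le_rfl (h3 k x))
    rw [← lintegral_const_mul _ ((hm k).pow_const r)]
    refine setLIntegral_mono' Metric.isClosed_closedBall.measurableSet fun z hz => ?_
    have hz' : ‖z‖ ≤ ‖x‖ + c := by
      rw [Metric.mem_closedBall, dist_eq_norm] at hz
      have := norm_sub_norm_le z x
      linarith
    refine (split_rpow hr hr1 (huB k z) (hut k z)).trans ?_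
    rw [mul_comm, ENNReal.mul_rpow_of_nonneg _ _ hr', hW]
    simp only
    rw [eE_rpow]
    gcongr
    refine eE_mono ?_
    gcongr
  have hBle : B ≤ (2 * C * eE (N * c) * S) * B ^ (1 - r) := by
    refine iSup_le fun j => iSup_le fun x => ENNReal.div_le_of_le_mul ((h1 j x).trans ?_)
    have hterm : ∀ k : ℕ, C * eE ((j * n - k * L) * Real.log 2) *
        ∫⁻ z in Metric.closedBall x c, u (j + k) z ≤
        C * eE (N * c) * S * B ^ (1 - r) * W j x * eE (-((k : ℝ) * Real.log 2)) := by
      intro k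
      refine (mul_le_mul' le_rfl (hI (j + k) x)).trans ?_
      have : eE ((j * n - k * L) * Real.log 2) *
          (eE ((((j + k : ℕ) : ℝ) * L * Real.log 2 + N * (‖x‖ + c)) * (1 - r)) *
          eE (((j + k : ℕ) : ℝ) * b * Real.log 2 + N * r * ‖x‖)) ≤
          eE (N * c) * (W j x * eE (-((k : ℝ) * Real.log 2))) := by
        rw [hW]
        simp only
        rw [← eE_add, ← eE_add, ← eE_add, ← eE_add]
        refine eE_mono ?_
        push_cast
        have hj : (0 : ℝ) ≤ j := Nat.cast_nonneg j
        have hk : (0 : ℝ) ≤ k := Nat.cast_nonneg k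
        have hn : (0 : ℝ) ≤ n := Nat.cast_nonneg n
        have a1 : (j : ℝ) * (n + b - r * L) ≤ 0 := mul_nonpos_of_nonneg_of_nonpos hj (by linarith)
        have a2 : (k : ℝ) * (b - r * L + 1) ≤ 0 := mul_nonpos_of_nonneg_of_nonpos hk (by linarith)
        have a3 : Real.log 2 * (j * (n + b - r * L) + k * (b - r * L + 1)) ≤ 0 :=
          mul_nonpos_of_nonneg_of_nonpos hlog.le (by linarith)
        have a4 : 0 ≤ N * c * r := by positivity
        linarith
      calc _ = C * S * B ^ (1 - r) * (eE ((j * n - k * L) * Real.log 2) *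
          (eE ((((j + k : ℕ) : ℝ) * L * Real.log 2 + N * (‖x‖ + c)) * (1 - r)) *
          eE (((j + k : ℕ) : ℝ) * b * Real.log 2 + N * r * ‖x‖))) := by ring
        _ ≤ C * S * B ^ (1 - r) * (eE (N * c) * (W j x * eE (-((k : ℝ) * Real.log 2)))) := by
          gcongr
        _ = _ := by ring
    refine (ENNReal.tsum_le_tsum hterm).trans (le_of_eq ?_)
    rw [ENNReal.tsum_mul_left, eE_tsum_half]
    ring
  have hfin := absorb hr hr1 hBt hBle
  refine le_trans ?_ hfin
  have h00 := huB 0 0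
  have : W 0 0 = 1 := by simp [hW, eE_zero]
  rw [this, mul_one] at h00
  gcongr

lemma lint_shift (v : (Fin n → ℝ) → ℝ≥0∞) (x0 x : Fin n → ℝ) (c : ℝ) :
    ∫⁻ z in Metric.closedBall x c, v (x0 + z) = ∫⁻ z in Metric.closedBall (x0 + x) c, v z := by
  rw [← lintegral_indicator Metric.isClosed_closedBall.measurableSet,
    ← lintegral_indicator Metric.isClosed_closedBall.measurableSet,
    ← lintegral_add_left_eq_self ((Metric.closedBall (x0 + x) c).indicator fun z => v z) x0]
  congr 1
  ext z
  simp [Set.indicator]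

lemma bootstrap1 (v : ℕ → (Fin n → ℝ) → ℝ≥0∞) {r c N N' L b : ℝ} (hr : 0 < r) (hr1 : r ≤ 1)
    (hc : 0 < c) (hN : 0 ≤ N) (hNN : N ≤ N') (hL : n + 1 + b ≤ r * L) {C A S : ℝ≥0∞} (hA : A ≠ ∞)
    (hm : ∀ k, Measurable (v k))
    (h1 : ∀ j x, v j x ≤ ∑' k : ℕ, C * eE ((j * n - k * L) * Real.log 2) *
      ∫⁻ z in Metric.closedBall x c, v (j + k) z)
    (h2 : ∀ k y, v k y ≤ A * eE (k * L * Real.log 2 + N' * ‖y‖))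
    (h3 : ∀ k x, ∫⁻ z in Metric.closedBall x c, v k z ^ r ≤
      S * eE (k * b * Real.log 2 + N * r * ‖x‖)) (j : ℕ) (x : Fin n → ℝ) :
    v j x ^ r ≤ 2 * C * eE (N' * c) * S * eE (j * (n + b) * Real.log 2 + N * r * ‖x‖) := by
  have key := bootstrap0 (fun k y => v (j + k) (x + y)) hr hr1 hc (hN.trans hNN) hL
    (C := C * eE (j * n * Real.log 2)) (A := A * eE (j * L * Real.log 2 + N' * ‖x‖))
    (S := S * eE (j * b * Real.log 2 + N * r * ‖x‖)) (ENNReal.mul_ne_top hA (eE_ne_top _))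
    (fun k => (hm _).comp (measurable_const_add x)) ?_ ?_ ?_
  · simp only [add_zero] at key
    refine key.trans (le_of_eq ?_)
    have e : (j * (n + b) * Real.log 2 + N * r * ‖x‖) =
      j * n * Real.log 2 + (j * b * Real.log 2 + N * r * ‖x‖) := by ring
    rw [e, eE_add (j * n * Real.log 2)]
    ring
  · intro i y
    refine (h1 _ _).trans (le_of_eq ?_)
    congr 1
    ext k
    rw [lint_shift (v (j + (i + k))) x y c, mul_assoc C (eE _) (eE _), ← eE_add, add_assoc]
    congr 3
    push_cast
    ring
  · intro k y
    refine (h2 _ _).trans ?_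
    rw [mul_assoc _ (eE _) (eE _), ← eE_add]
    refine mul_le_mul' le_rfl (eE_mono ?_)
    have := mul_le_mul_of_nonneg_left (norm_add_le x y) (hN.trans hNN)
    push_cast
    linarith
  · intro k y
    rw [lint_shift (fun z => v (j + k) z ^ r) x y c]
    refine (h3 _ _).trans ?_
    rw [mul_assoc _ (eE _) (eE _), ← eE_add]
    refine mul_le_mul' le_rfl (eE_mono ?_)
    have a := mul_le_mul_of_nonneg_left (norm_add_le x y) (mul_nonneg hN hr.le)
    have b : N * r * ‖y‖ ≤ N' * r * ‖y‖ := by gcongr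
    push_cast
    linarith

lemma coef_eE (C : ℝ) (hC : 0 < C) (k L : ℕ) (j m : ℕ) :
    ENNReal.ofReal (C * (1 / 2) ^ (k * L) * 2 ^ (j * m))
      = ENNReal.ofReal C * eE ((j * m - k * L) * Real.log 2) := by
  rw [eE_two, ← ENNReal.ofReal_mul hC.le, Real.rpow_sub two_pos]
  congr 1
  have e1 : (2 : ℝ) ^ ((j : ℝ) * m) = 2 ^ (j * m) := by
    rw [← Nat.cast_mul, Real.rpow_natCast]
  have e2 : (2 : ℝ) ^ ((k : ℝ) * L) = 2 ^ (k * L) := by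
    rw [← Nat.cast_mul, Real.rpow_natCast]
  rw [e1, e2, one_div, inv_pow]
  ring

lemma pointwise {φ : TD n} (hint : ∫ x, φ.1 x = 1) {r N b : ℝ} (hr : 0 < r) (hr1 : r ≤ 1)
    (hN : 0 ≤ N) (K : ℝ → ℝ≥0∞) (hK : ∀ c, K c ≠ ∞) :
    ∃ D : ℝ≥0∞, D ≠ ∞ ∧ ∀ f : Dstrb n, MemSe' n f → ∀ S : ℝ≥0∞, S ≠ ∞ →
      (∀ c, 0 < c → ∀ k x, ∫⁻ z in Metric.closedBall x c, ‖distConv n f (PT φ k).1 z‖ₑ ^ r ≤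
        K c * S * eE (k * b * Real.log 2 + N * r * ‖x‖)) →
      ∀ (j : ℕ) x, ‖distConv n f (PT φ j).1 x‖ₑ ^ r ≤
        D * S * eE (j * (n + b) * Real.log 2 + N * r * ‖x‖) := by
  choose C c hC hc hrep using fun L => rep1 hint L
  obtain ⟨L0, hL0⟩ := exists_nat_ge ((n + 1 + b) / r)
  rw [div_le_iff₀ hr] at hL0
  have hlog : 0 < Real.log 2 := Real.log_pos one_lt_two
  refine ⟨2 * ENNReal.ofReal (C L0) * eE (N * c L0) * K (c L0), ?_, ?_⟩
  · exact ENNReal.mul_ne_top (ENNReal.mul_ne_top (ENNReal.mul_ne_top (by simp)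
      ENNReal.ofReal_ne_top) (eE_ne_top _)) (hK _)
  intro f hf S hS h3 j x
  have hm : ∀ k, Measurable fun x => ‖distConv n f (PT φ k).1 x‖ₑ := fun k =>
    (distConv_continuous hf (PT φ k).test).measurable.enorm
  have h1 : ∀ (L : ℕ) (j : ℕ) x, ‖distConv n f (PT φ j).1 x‖ₑ ≤
      ∑' k : ℕ, ENNReal.ofReal (C L) * eE ((j * n - k * L) * Real.log 2) *
      ∫⁻ z in Metric.closedBall x (c L), ‖distConv n f (PT φ (j + k)).1 z‖ₑ := by
    intro L j x
    refine (hrep L f hf j x).trans (le_of_eq ?_)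
    congr 1
    ext k
    rw [coef_eE _ (hC L)]
    rfl
  obtain ⟨A, M, hA, hap⟩ := apriori_PT hf φ
  have hM : (0 : ℝ) ≤ M := Nat.cast_nonneg M
  have hnn : (0 : ℝ) ≤ n := Nat.cast_nonneg n
  have hL00 : (0 : ℝ) ≤ L0 := Nat.cast_nonneg L0
  have s1 := bootstrap1 (fun k x => ‖distConv n f (PT φ k).1 x‖ₑ) (L := (L0 + n + M : ℕ))
    (N := N) (N' := N + M) (b := b) (A := ENNReal.ofReal A) hr hr1 (hc (L0 + n + M)) hN
    (by linarith) (by push_cast; nlinarith) ENNReal.ofReal_ne_top hm (h1 _)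
    (fun k y => by
      refine (hap k y).trans ?_
      rw [eE, ← ENNReal.ofReal_mul hA.le]
      refine ENNReal.ofReal_le_ofReal ?_
      rw [mul_assoc]
      refine mul_le_mul_of_nonneg_left ?_ hA.le
      have e : (2 : ℝ) ^ (k * (n + M)) = Real.exp ((k * (n + M) : ℕ) * Real.log 2) := by
        rw [Real.exp_nat_mul, Real.exp_log two_pos]
      rw [e, ← Real.exp_add]
      refine Real.exp_le_exp.2 ?_
      push_cast
      have a1 : 0 ≤ (k : ℝ) * L0 * Real.log 2 := by positivity
      have a2 : 0 ≤ N * ‖y‖ := by positivity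
      linarith) (h3 _ (hc _))
  set X := 2 * ENNReal.ofReal (C (L0 + n + M)) * eE ((N + M) * c (L0 + n + M)) *
    (K (c (L0 + n + M)) * S) with hX
  have hXt : X ≠ ∞ := ENNReal.mul_ne_top (ENNReal.mul_ne_top (ENNReal.mul_ne_top (by simp)
      ENNReal.ofReal_ne_top) (eE_ne_top _)) (ENNReal.mul_ne_top (hK _) hS)
  have s2 := bootstrap1 (fun k x => ‖distConv n f (PT φ k).1 x‖ₑ) (L := L0)
    (N := N) (N' := N) (b := b) (A := X ^ (1 / r)) hr hr1 (hc L0) hN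
    le_rfl (by linarith) (ENNReal.rpow_ne_top_of_nonneg (by positivity) hXt) hm (h1 _)
    (fun k y => by
      have := s1 k y
      rw [← ENNReal.le_rpow_inv_iff hr, ENNReal.mul_rpow_of_nonneg _ _ (by positivity),
        eE_rpow] at this
      refine this.trans ?_
      rw [one_div]
      refine mul_le_mul' le_rfl (eE_mono ?_)
      rw [← div_eq_mul_inv, div_le_iff₀ hr]
      have hk : (0 : ℝ) ≤ k := Nat.cast_nonneg k
      have a1 : (k : ℝ) * (n + b) * Real.log 2 ≤ k * (L0 * r) * Real.log 2 := by
        gcongr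
        linarith
      linarith) (h3 _ (hc _)) j x
  refine s2.trans (le_of_eq ?_)
  ring

end Bootstrap

section Weights
variable {n : ℕ}

lemma le_lqNorm {q : ℝ≥0∞} (hq : 0 < q) (a : ℕ → ℝ≥0∞) (k : ℕ) : a k ≤ lqNorm q a := by
  unfold lqNorm
  split_ifs with h
  · exact le_iSup a k
  · have hq' : 0 < q.toReal := ENNReal.toReal_pos hq.ne' h
    rw [one_div, ENNReal.le_rpow_inv_iff hq']
    exact ENNReal.le_tsum (f := fun k => a k ^ q.toReal) k

lemma dyadicCube_zero (m : Fin n → ℤ) : dyadicCube n 0 m =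
    Set.Icc (fun i => (m i : ℝ)) (fun i => (m i : ℝ) + 1) := by
  ext x
  simp [dyadicCube, Set.mem_Icc, Pi.le_def, forall_and]

lemma cube_prob (m : Fin n → ℤ) :
    IsProbabilityMeasure ((volume : Measure (Fin n → ℝ)).restrict (dyadicCube n 0 m)) := by
  refine ⟨?_⟩
  rw [Measure.restrict_apply_univ, dyadicCube_zero, Real.volume_Icc_pi]
  simp

lemma chain_bound (T : (Fin n → ℤ) → ℝ≥0∞) (κ : ℝ≥0∞)
    (h : ∀ m m' : Fin n → ℤ, (∀ i, |m i - m' i| ≤ 1) → T m ≤ κ * T m') (M : ℕ) :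
    ∀ m : Fin n → ℤ, (∀ i, |m i| ≤ M) → T 0 ≤ κ ^ M * T m := by
  induction M with
  | zero =>
    intro m hm
    have : m = 0 := by
      ext i
      have := hm i
      simpa using this
    simp [this]
  | succ M ih =>
    intro m hm
    have h1 := ih (fun i => m i - (m i).sign) (fun i => by
      have := hm i
      rcases lt_trichotomy (m i) 0 with h | h | h
      · rw [Int.sign_eq_neg_one_of_neg h, abs_le]
        rw [abs_le] at this
        push_cast at this ⊢
        constructor <;> omega
      · simp [h]
      · rw [Int.sign_eq_one_of_pos h, abs_le]
        rw [abs_le] at this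
        push_cast at this ⊢
        constructor <;> omega)
    have h2 := h (fun i => m i - (m i).sign) m (fun i => by
      have : m i - (m i).sign - m i = - (m i).sign := by ring
      rw [this, abs_neg]
      rcases lt_trichotomy (m i) 0 with h | h | h
      · rw [Int.sign_eq_neg_one_of_neg h]; simp
      · simp [h]
      · rw [Int.sign_eq_one_of_pos h]; simp)
    calc T 0 ≤ _ := h1
      _ ≤ κ ^ M * (κ * T m) := by gcongr
      _ = _ := by ring

lemma cube_bound {p σ₁ : ℝ≥0∞} {r : ℝ} (hr : 0 < r)
    (hrr : ENNReal.ofReal r ≤ (σ₁⁻¹ + p⁻¹)⁻¹) {w F : (Fin n → ℝ) → ℝ} (hw : Measurable w)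
    (hF : Measurable F) (hpos : ∀ᵐ x, 0 < w x) (m : Fin n → ℤ) :
    ∫⁻ z in dyadicCube n 0 m, ‖F z‖ₑ ^ r ≤
      (eLpNorm (fun x => (w x)⁻¹) σ₁ (volume.restrict (dyadicCube n 0 m)) *
        eLpNorm (fun x => w x * F x) p volume) ^ r := by
  have := cube_prob m
  set μ := (volume : Measure (Fin n → ℝ)).restrict (dyadicCube n 0 m) with hμ
  have hr0 : ENNReal.ofReal r ≠ 0 := by simpa using hr
  have e1 : ∫⁻ z in dyadicCube n 0 m, ‖F z‖ₑ ^ r = eLpNorm F (ENNReal.ofReal r) μ ^ r := by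
    rw [eLpNorm_eq_lintegral_rpow_enorm_toReal hr0 ENNReal.ofReal_ne_top,
      ENNReal.toReal_ofReal hr.le, one_div, ENNReal.rpow_inv_rpow hr.ne']
  rw [e1]
  refine ENNReal.rpow_le_rpow ?_ hr.le
  refine (eLpNorm_le_eLpNorm_of_exponent_le hrr hF.aestronglyMeasurable).trans ?_
  have hH : ENNReal.HolderTriple σ₁ p (σ₁⁻¹ + p⁻¹)⁻¹ := ⟨by rw [inv_inv]⟩
  have e2 : eLpNorm F (σ₁⁻¹ + p⁻¹)⁻¹ μ =
      eLpNorm ((fun x => (w x)⁻¹) • (fun x => w x * F x)) (σ₁⁻¹ + p⁻¹)⁻¹ μ := by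
    refine eLpNorm_congr_ae ?_
    filter_upwards [ae_restrict_of_ae hpos] with x hx
    simp only [Pi.smul_apply', smul_eq_mul]
    rw [← mul_assoc, inv_mul_cancel₀ hx.ne', one_mul]
  rw [e2]
  refine (eLpNorm_smul_le_mul_eLpNorm (p := σ₁) (q := p) (r := (σ₁⁻¹ + p⁻¹)⁻¹) (hw.mul hF).aestronglyMeasurable
    hw.inv.aestronglyMeasurable).trans ?_
  exact mul_le_mul' le_rfl (eLpNorm_mono_measure _ Measure.restrict_le_self)

/-- indices of the unit cubes that meet a ball -/
def cubeIdx (x : Fin n → ℝ) (c : ℝ) : Finset (Fin n → ℤ) :=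
  Fintype.piFinset fun i => Finset.Icc ⌊x i - c⌋ ⌊x i + c⌋

lemma cubeIdx_card (x : Fin n → ℝ) (c : ℝ) : (cubeIdx x c).card ≤ (⌈2 * c⌉₊ + 2) ^ n := by
  rw [cubeIdx, Fintype.card_piFinset]
  refine (Finset.prod_le_pow_card _ _ (⌈2 * c⌉₊ + 2) fun i _ => ?_).trans (le_of_eq (by simp))
  rw [Int.card_Icc]
  have h1 : (⌊x i + c⌋ : ℝ) ≤ x i + c := Int.floor_le _
  have h2 : x i - c < ⌊x i - c⌋ + 1 := Int.lt_floor_add_one _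
  have h3 := Nat.le_ceil (2 * c)
  have h4 : ((⌊x i + c⌋ + 1 - ⌊x i - c⌋ : ℤ) : ℝ) ≤ ((⌈2 * c⌉₊ + 2 : ℕ) : ℤ) := by
    push_cast
    linarith
  have h5 : (⌊x i + c⌋ + 1 - ⌊x i - c⌋ : ℤ) ≤ ((⌈2 * c⌉₊ + 2 : ℕ) : ℤ) := by exact_mod_cast h4
  omega

lemma cubeIdx_cover (x : Fin n → ℝ) (c : ℝ) :
    Metric.closedBall x c ⊆ ⋃ m : cubeIdx x c, dyadicCube n 0 m.1 := by
  intro z hz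
  rw [Metric.mem_closedBall, dist_eq_norm] at hz
  have hi : ∀ i, |z i - x i| ≤ c := fun i => (norm_le_pi_norm (z - x) i).trans hz
  refine Set.mem_iUnion.2 ⟨⟨fun i => ⌊z i⌋, ?_⟩, ?_⟩
  · rw [cubeIdx, Fintype.mem_piFinset]
    intro i
    have := abs_le.1 (hi i)
    rw [Finset.mem_Icc]
    exact ⟨Int.floor_mono (by linarith), Int.floor_mono (by linarith)⟩
  · intro i
    simp only [pow_zero, div_one]
    exact ⟨Int.floor_le _, (Int.lt_floor_add_one _).le⟩

lemma cubeIdx_abs {x : Fin n → ℝ} {c : ℝ} (hc : 0 < c) {m : Fin n → ℤ} (hm : m ∈ cubeIdx x c)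
    (i : Fin n) : |m i| ≤ (⌈‖x‖ + c + 1⌉₊ : ℤ) := by
  rw [cubeIdx, Fintype.mem_piFinset] at hm
  have h := Finset.mem_Icc.1 (hm i)
  have hx : |x i| ≤ ‖x‖ := norm_le_pi_norm x i
  have hx' := abs_le.1 hx
  have h1 : (m i : ℝ) ≤ x i + c := (Int.le_floor.1 h.2)
  have h2 : x i - c - 1 < m i := by
    have a : x i - c < ⌊x i - c⌋ + 1 := Int.lt_floor_add_one _
    have b : (⌊x i - c⌋ : ℝ) ≤ m i := by exact_mod_cast h.1
    linarith
  have h3 := Nat.le_ceil (‖x‖ + c + 1)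
  have : |(m i : ℝ)| ≤ (⌈‖x‖ + c + 1⌉₊ : ℝ) := by
    rw [abs_le]
    constructor <;> linarith
  exact_mod_cast this

lemma weights_bound {p q σ₁ σ₂ : ℝ≥0∞} {α₁ α₂ α₃ : ℝ} (hα₃ : 0 ≤ α₃) (hq : 0 < q)
    {t : ℕ → (Fin n → ℝ) → ℝ} (ht : MemX n p σ₁ σ₂ α₁ α₂ α₃ t) (φ : TD n) {r : ℝ} (hr : 0 < r)
    (hrr : ENNReal.ofReal r ≤ (σ₁⁻¹ + p⁻¹)⁻¹) :
    ∃ K : ℝ → ℝ≥0∞, (∀ c, K c ≠ ∞) ∧ ∀ f : Dstrb n, MemSe' n f → ∀ c, 0 < c → ∀ (k : ℕ) x,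
      ∫⁻ z in Metric.closedBall x c, ‖distConv n f (PT φ k).1 z‖ₑ ^ r ≤
        K c * besovNorm n p q t φ.1 f ^ r *
          eE (k * (-α₁ * r) * Real.log 2 + α₃ * Real.log 2 * r * ‖x‖) := by
  obtain ⟨⟨hmeas, hpos, hfin⟩, ⟨C₁, hC₁, hi⟩, -, ht0, hiii⟩ := ht
  set T : (Fin n → ℤ) → ℝ≥0∞ := tkm n p t 0 with hT
  have hlog : 0 < Real.log 2 := Real.log_pos one_lt_two
  set Q : ℝ≥0∞ := ENNReal.ofReal C₁ / T 0 with hQ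
  have hQt : Q ≠ ∞ := ENNReal.div_ne_top ENNReal.ofReal_ne_top (ht0 0 0).ne'
  refine ⟨fun c => ((⌈2 * c⌉₊ + 2) ^ n : ℕ) * (Q ^ r * eE (α₃ * Real.log 2 * (c + 2) * r)),
    fun c => ?_, fun f hf c hc k x => ?_⟩
  · exact ENNReal.mul_ne_top (ENNReal.natCast_ne_top _)
      (ENNReal.mul_ne_top (ENNReal.rpow_ne_top_of_nonneg hr.le hQt) (eE_ne_top _))
  set Bs := besovNorm n p q t φ.1 f with hBs
  -- weights on cubes
  have hE : ∀ m ∈ cubeIdx x c,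
      eLpNorm (fun x => (t k x)⁻¹) σ₁ (volume.restrict (dyadicCube n 0 m)) ≤
        Q * eE (k * (-α₁) * Real.log 2 + α₃ * Real.log 2 * (‖x‖ + c + 2)) := by
    intro m hm
    have h1 := hi 0 k (Nat.zero_le k) m
    simp only [zero_mul, pow_zero, ENNReal.one_rpow, one_mul] at h1
    have h2 := chain_bound T (ENNReal.ofReal (2 ^ α₃)) (fun m m' h => hiii 0 m m' h)
      ⌈‖x‖ + c + 1⌉₊ m (cubeIdx_abs hc hm)
    have h3 : ENNReal.ofReal (2 ^ α₃) ^ ⌈‖x‖ + c + 1⌉₊ ≤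
        eE (α₃ * Real.log 2 * (‖x‖ + c + 2)) := by
      rw [← eE_two, ← ENNReal.rpow_natCast, eE_rpow]
      refine eE_mono ?_
      have := Nat.ceil_lt_add_one (a := ‖x‖ + c + 1) (by positivity)
      gcongr
      linarith
    have h4 : ENNReal.ofReal (C₁ * 2 ^ (α₁ * (((0 : ℕ) : ℝ) - (k : ℝ)))) =
        ENNReal.ofReal C₁ * eE (k * (-α₁) * Real.log 2) := by
      rw [eE_two, ← ENNReal.ofReal_mul hC₁.le]
      congr 3
      push_cast
      ring
    rw [h4] at h1
    set Em := eLpNorm (fun x => (t k x)⁻¹) σ₁ (volume.restrict (dyadicCube n 0 m))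
    have h5 : Em * T 0 ≤ ENNReal.ofReal C₁ *
        eE (k * (-α₁) * Real.log 2 + α₃ * Real.log 2 * (‖x‖ + c + 2)) := by
      calc Em * T 0 ≤ Em * (eE (α₃ * Real.log 2 * (‖x‖ + c + 2)) * T m) := by
            refine mul_le_mul' le_rfl (h2.trans (mul_le_mul' h3 le_rfl))
        _ = eE (α₃ * Real.log 2 * (‖x‖ + c + 2)) * (T m * Em) := by ring
        _ ≤ eE (α₃ * Real.log 2 * (‖x‖ + c + 2)) *
            (ENNReal.ofReal C₁ * eE (k * (-α₁) * Real.log 2)) := mul_le_mul' le_rfl h1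
        _ = _ := by rw [eE_add]; ring
    rw [← ENNReal.le_div_iff_mul_le (Or.inl (ht0 0 0).ne') (Or.inl (hfin 0 0).ne)] at h5
    refine h5.trans (le_of_eq ?_)
    rw [hQ, div_eq_mul_inv, div_eq_mul_inv]
    ring
  have hB : eLpNorm (fun x => t k x * distConv n f (PT φ k).1 x) p volume ≤ Bs := by
    have := le_lqNorm hq (fun k =>
      eLpNorm (fun x => t k x * distConv n f (phiFam n φ.1 k) x) p volume) k
    simp only [← PT_coe] at this
    refine this.trans (le_of_eq ?_)
    rw [hBs, besovNorm]
    simp only [← PT_coe]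
  have hcube : ∀ m ∈ cubeIdx x c, ∫⁻ z in dyadicCube n 0 m, ‖distConv n f (PT φ k).1 z‖ₑ ^ r ≤
      (Q * eE (k * (-α₁) * Real.log 2 + α₃ * Real.log 2 * (‖x‖ + c + 2)) * Bs) ^ r := by
    intro m hm
    refine (cube_bound hr hrr (hmeas k) (distConv_continuous hf (PT φ k).test).measurable
      (hpos k) m).trans ?_
    exact ENNReal.rpow_le_rpow (mul_le_mul' (hE m hm) hB) hr.le
  calc _ ≤ ∫⁻ z in ⋃ m : cubeIdx x c, dyadicCube n 0 m.1, ‖distConv n f (PT φ k).1 z‖ₑ ^ r :=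
        lintegral_mono_set (cubeIdx_cover x c)
    _ ≤ ∑' m : cubeIdx x c, ∫⁻ z in dyadicCube n 0 m.1, ‖distConv n f (PT φ k).1 z‖ₑ ^ r :=
        lintegral_iUnion_le _ _
    _ = ∑ m : cubeIdx x c, ∫⁻ z in dyadicCube n 0 m.1, ‖distConv n f (PT φ k).1 z‖ₑ ^ r :=
        tsum_fintype _
    _ ≤ ∑ m : cubeIdx x c,
        (Q * eE (k * (-α₁) * Real.log 2 + α₃ * Real.log 2 * (‖x‖ + c + 2)) * Bs) ^ r :=
        Finset.sum_le_sum fun m _ => hcube m.1 m.2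
    _ = (cubeIdx x c).card *
        (Q * eE (k * (-α₁) * Real.log 2 + α₃ * Real.log 2 * (‖x‖ + c + 2)) * Bs) ^ r := by
        rw [Finset.sum_const, nsmul_eq_mul]; simp
    _ ≤ (((⌈2 * c⌉₊ + 2) ^ n : ℕ) : ℝ≥0∞) *
        (Q * eE (k * (-α₁) * Real.log 2 + α₃ * Real.log 2 * (‖x‖ + c + 2)) * Bs) ^ r := by
        refine mul_le_mul' ?_ le_rfl
        exact_mod_cast cubeIdx_card x c
    _ = _ := by
        rw [ENNReal.mul_rpow_of_nonneg _ _ hr.le, ENNReal.mul_rpow_of_nonneg _ _ hr.le, eE_rpow]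
        have : (k * (-α₁) * Real.log 2 + α₃ * Real.log 2 * (‖x‖ + c + 2)) * r =
          α₃ * Real.log 2 * (c + 2) * r + (k * (-α₁ * r) * Real.log 2 +
            α₃ * Real.log 2 * r * ‖x‖) := by ring
        rw [this, eE_add (α₃ * Real.log 2 * (c + 2) * r)]
        ring

end Weights

lemma suppB_of_cube {n : ℕ} {θ : (Fin n → ℝ) → ℝ} (hs : tsupport θ ⊆ unitCube n) : SuppB 1 θ := by
  intro x hx
  by_contra h
  have h1 : x ∈ unitCube n := hs (subset_tsupport _ h)
  have h2 : ‖x‖ ≤ 1 := (pi_norm_le_iff_of_nonneg zero_le_one).2 fun i => by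
    rw [Real.norm_eq_abs]; exact h1 i
  linarith

lemma sup_ne_top {n : ℕ} {θ : (Fin n → ℝ) → ℝ} (hθ : IsTestFun n θ) (L : ℕ) :
    (⨆ y : Fin n → ℝ, ENNReal.ofReal
      (∑ i ∈ Finset.range (L + 1), ‖iteratedFDeriv ℝ i θ y‖)) ≠ ∞ := by
  choose B hB0 hB using fun i => hθ.exists_bound i
  refine ne_top_of_le_ne_top (b := ENNReal.ofReal (∑ i ∈ Finset.range (L + 1), B i))
    ENNReal.ofReal_ne_top (iSup_le fun y => ENNReal.ofReal_le_ofReal ?_)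
  exact Finset.sum_le_sum fun i _ => hB i y

lemma DB_of_sup {n : ℕ} {θ : (Fin n → ℝ) → ℝ} (hθ : IsTestFun n θ) (L i : ℕ) (hi : i ≤ L) :
    DB i (⨆ y : Fin n → ℝ, ENNReal.ofReal
      (∑ i ∈ Finset.range (L + 1), ‖iteratedFDeriv ℝ i θ y‖)).toReal θ := by
  intro x
  have h0 : ‖iteratedFDeriv ℝ i θ x‖ ≤ ∑ i ∈ Finset.range (L + 1), ‖iteratedFDeriv ℝ i θ x‖ :=
    Finset.single_le_sum (f := fun i => ‖iteratedFDeriv ℝ i θ x‖) (fun _ _ => norm_nonneg _)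
      (Finset.mem_range.2 (by omega))
  refine h0.trans ((ENNReal.ofReal_le_iff_le_toReal (sup_ne_top hθ L)).1 ?_)
  exact le_iSup (fun y => ENNReal.ofReal
      (∑ i ∈ Finset.range (L + 1), ‖iteratedFDeriv ℝ i θ y‖)) x

lemma root_bound {r : ℝ} (hr : 0 < r) {a D S : ℝ≥0∞} {s : ℝ}
    (h : a ^ r ≤ D * S ^ r * eE (s * r)) : a ≤ D ^ (1 / r) * S * eE s := by
  have h1 := ENNReal.rpow_le_rpow h (by positivity : 0 ≤ 1 / r)
  have e : r * (1 / r) = 1 := by field_simp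
  rw [← ENNReal.rpow_mul, e, ENNReal.rpow_one, ENNReal.mul_rpow_of_nonneg _ _ (by positivity),
    ENNReal.mul_rpow_of_nonneg _ _ (by positivity), ← ENNReal.rpow_mul, e, ENNReal.rpow_one,
    eE_rpow, mul_assoc s, e, mul_one] at h1
  exact h1

lemma exists_r {p σ₁ : ℝ≥0∞} (hp : 0 < p) (hσ₁ : 0 < σ₁) :
    ∃ r : ℝ, 0 < r ∧ r ≤ 1 ∧ ENNReal.ofReal r ≤ (σ₁⁻¹ + p⁻¹)⁻¹ := by
  have h0 : (σ₁⁻¹ + p⁻¹)⁻¹ ≠ 0 := by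
    rw [Ne, ENNReal.inv_eq_zero, ENNReal.add_eq_top]
    simp [hp.ne', hσ₁.ne']
  have ht : min (σ₁⁻¹ + p⁻¹)⁻¹ 1 ≠ ∞ := ne_top_of_le_ne_top ENNReal.one_ne_top (min_le_right _ _)
  refine ⟨(min (σ₁⁻¹ + p⁻¹)⁻¹ 1).toReal, ENNReal.toReal_pos ?_ ht, ?_, ?_⟩
  · have : 0 < min (σ₁⁻¹ + p⁻¹)⁻¹ 1 := lt_min (pos_iff_ne_zero.2 h0) one_pos
    exact this.ne'
  · exact ENNReal.toReal_le_of_le_ofReal zero_le_one (by simp)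
  · rw [ENNReal.ofReal_toReal ht]; exact min_le_left _ _

lemma sum_bound {n : ℕ} {f : Dstrb n} {φ : TD n} {E S : ℝ≥0∞} {a N c C B : ℝ} {L : ℕ}
    (hN : 0 ≤ N) (hC : 0 < C) (hB : 0 ≤ B) (hL : a + 1 ≤ L)
    (h : ∀ k : ℕ, ∀ x, ‖distConv n f (PT φ k).1 x‖ₑ ≤ E * S * eE (k * a * Real.log 2 + N * ‖x‖))
    (x : Fin n → ℝ) :
    ∑' k : ℕ, ENNReal.ofReal (C * (1/2)^(k*L) * B) * JB f (PT φ k) x c ≤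
      (2 * ENNReal.ofReal C * E * eE (N * c) * volume (Metric.closedBall (0 : Fin n → ℝ) c)) *
        S * ENNReal.ofReal B * eE (N * ‖x‖) := by
  have hJ : ∀ k : ℕ, JB f (PT φ k) x c ≤ E * S * eE (k * a * Real.log 2 + N * (‖x‖ + c)) *
      volume (Metric.closedBall (0 : Fin n → ℝ) c) := by
    intro k
    have : volume (Metric.closedBall (0 : Fin n → ℝ) c) = volume (Metric.closedBall x c) :=
      (Measure.addHaar_closedBall_center volume x c).symm
    rw [this, ← setLIntegral_const]
    refine setLIntegral_mono' Metric.isClosed_closedBall.measurableSet fun z hz => ?_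
    refine (h k z).trans (mul_le_mul' le_rfl (eE_mono ?_))
    have : ‖z‖ ≤ ‖x‖ + c := by
      have h1 : ‖z - x‖ ≤ c := by rwa [← dist_eq_norm]
      have h2 := norm_le_norm_add_norm_sub' z x
      linarith
    nlinarith
  have hterm : ∀ k : ℕ, ENNReal.ofReal (C * (1/2)^(k*L) * B) * JB f (PT φ k) x c ≤
      (ENNReal.ofReal C * E * eE (N * c) * volume (Metric.closedBall (0 : Fin n → ℝ) c) *
        S * ENNReal.ofReal B * eE (N * ‖x‖)) * eE (-(k * Real.log 2)) := by
    intro k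
    have e1 : ENNReal.ofReal (C * (1/2)^(k*L) * B) =
        ENNReal.ofReal C * eE (-((k * L : ℕ) * Real.log 2)) * ENNReal.ofReal B := by
      rw [ENNReal.ofReal_mul (by positivity), ENNReal.ofReal_mul hC.le]
      congr 2
      rw [eE, one_div, inv_pow, ← Real.rpow_natCast, ← Real.rpow_neg (by norm_num),
        Real.rpow_def_of_pos (by norm_num)]
      congr 2; ring
    rw [e1]
    calc _ ≤ ENNReal.ofReal C * eE (-((k * L : ℕ) * Real.log 2)) * ENNReal.ofReal B *
          (E * S * eE (k * a * Real.log 2 + N * (‖x‖ + c)) *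
            volume (Metric.closedBall (0 : Fin n → ℝ) c)) := mul_le_mul' le_rfl (hJ k)
      _ = (ENNReal.ofReal C * E * volume (Metric.closedBall (0 : Fin n → ℝ) c) *
        S * ENNReal.ofReal B) * (eE (-((k * L : ℕ) * Real.log 2)) *
          eE (k * a * Real.log 2 + N * (‖x‖ + c))) := by ring
      _ ≤ (ENNReal.ofReal C * E * volume (Metric.closedBall (0 : Fin n → ℝ) c) *
        S * ENNReal.ofReal B) * (eE (N * c) * eE (N * ‖x‖) * eE (-(k * Real.log 2))) := by
          refine mul_le_mul' le_rfl ?_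
          rw [← eE_add, ← eE_add, ← eE_add]
          refine eE_mono ?_
          have h2 : 0 ≤ (k : ℝ) * Real.log 2 :=
            mul_nonneg (Nat.cast_nonneg _) (Real.log_nonneg (by norm_num))
          push_cast
          nlinarith [mul_le_mul_of_nonneg_left hL h2]
      _ = _ := by ring
  refine (ENNReal.tsum_le_tsum hterm).trans ?_
  rw [ENNReal.tsum_mul_left, eE_tsum_half]
  refine le_of_eq ?_
  ring

/-- estimate (3.14) for convolutions with test functions supported in `I`. -/
theorem convolution_exponential_estimate (n : ℕ) (p q σ₁ σ₂ : ℝ≥0∞) (α₁ α₂ α₃ : ℝ)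
    (hp : 0 < p) (hq : 0 < q) (hσ₁ : 0 < σ₁) (hσ₂ : 0 < σ₂) (hα₃ : 0 ≤ α₃)
    (t : ℕ → (Fin n → ℝ) → ℝ) (ht : MemX n p σ₁ σ₂ α₁ α₂ α₃ t)
    (φ₀ : (Fin n → ℝ) → ℝ) (hφ₀ : IsTestFun n φ₀) (hint : (∫ x, φ₀ x) = 1) :
    ∃ (C N : ℝ) (L : ℕ), 0 < C ∧ 0 < N ∧
      ∀ f : Dstrb n, MemSe' n f → besovNorm n p q t φ₀ f ≠ ∞ →
        ∀ θ : (Fin n → ℝ) → ℝ, IsTestFun n θ → tsupport θ ⊆ unitCube n →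
          ∀ x : Fin n → ℝ,
            ENNReal.ofReal |distConv n f θ x| ≤
              ENNReal.ofReal C * besovNorm n p q t φ₀ f *
                (⨆ y : Fin n → ℝ, ENNReal.ofReal
                  (∑ i ∈ Finset.range (L + 1), ‖iteratedFDeriv ℝ i θ y‖)) *
                ENNReal.ofReal (Real.exp (N * ‖x‖)) := by
  obtain ⟨r, hr, hr1, hrr⟩ := exists_r hp hσ₁
  let φ : TD n := ⟨φ₀, hφ₀⟩
  obtain ⟨K, hK, hW⟩ := weights_bound hα₃ hq ht φ hr hrr
  have hlog : 0 ≤ Real.log 2 := Real.log_nonneg (by norm_num)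
  have hN : 0 ≤ α₃ * Real.log 2 := mul_nonneg hα₃ hlog
  obtain ⟨D, hD, hP⟩ := pointwise (φ := φ) (b := -α₁ * r) hint hr hr1 hN K hK
  set a : ℝ := ((n : ℝ) + -α₁ * r) / r with ha
  obtain ⟨L, hL⟩ := exists_nat_ge (a + 1)
  obtain ⟨C, c, hC, hc, hR⟩ := rep2 (φ := φ) hint L
  set A : ℝ≥0∞ := 2 * ENNReal.ofReal C * D ^ (1 / r) * eE (α₃ * Real.log 2 * c) *
    volume (Metric.closedBall (0 : Fin n → ℝ) c) with hA
  have hAt : A ≠ ∞ := by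
    refine ENNReal.mul_ne_top (ENNReal.mul_ne_top (ENNReal.mul_ne_top (ENNReal.mul_ne_top
      (by simp) ENNReal.ofReal_ne_top) ?_) (eE_ne_top _)) measure_closedBall_lt_top.ne
    exact ENNReal.rpow_ne_top_of_nonneg (by positivity) hD
  refine ⟨A.toReal + 1, α₃ * Real.log 2 + 1, L, by positivity, by positivity, ?_⟩
  intro f hf hS θ hθ hs x
  set S := besovNorm n p q t φ₀ f with hSdef
  have hpt : ∀ k : ℕ, ∀ x, ‖distConv n f (PT φ k).1 x‖ₑ ≤
      D ^ (1 / r) * S * eE (k * a * Real.log 2 + α₃ * Real.log 2 * ‖x‖) := by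
    intro k x
    refine root_bound hr ?_
    refine (hP f hf (S ^ r) (ENNReal.rpow_ne_top_of_nonneg hr.le hS)
      (fun c hc k x => hW f hf c hc k x) k x).trans (le_of_eq ?_)
    congr 2
    rw [ha]; field_simp
  set M := ⨆ y : Fin n → ℝ, ENNReal.ofReal
      (∑ i ∈ Finset.range (L + 1), ‖iteratedFDeriv ℝ i θ y‖) with hM
  have h1 := hR f hf ⟨θ, hθ⟩ M.toReal ENNReal.toReal_nonneg (suppB_of_cube hs)
    (DB_of_sup hθ L 0 (Nat.zero_le _)) (DB_of_sup hθ L L le_rfl) x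
  have h2 := h1.trans (sum_bound hN hC ENNReal.toReal_nonneg hL hpt x)
  rw [ENNReal.ofReal_toReal (sup_ne_top hθ L)] at h2
  rw [← Real.enorm_eq_ofReal_abs]
  refine h2.trans (mul_le_mul' (mul_le_mul' (mul_le_mul' ?_ le_rfl) le_rfl) ?_)
  · rw [← hA]
    refine (ENNReal.ofReal_toReal hAt).symm.le.trans (ENNReal.ofReal_le_ofReal (by linarith))
  · exact eE_mono (mul_le_mul_of_nonneg_right (by linarith) (norm_nonneg _))
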